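/- arXiv:1202.5774 — 4 statements merged into one kernel-verified Lean document; each statement's English description precedes it below -/
import Mathlib

section
/- Let ε = 4 + √17 (a unit of the ring of integers of ℚ(√17)). Let q be a prime with q ≡ 1 (mod 4) such that 17 is a quadratic residue modulo q, and let 𝔔 be any prime ideal of the ring of integers of ℚ(√17) lying above q. If there exist integers x, y with q = x² + 17y², then ε^{(q−1)/2} ≡ 1 (mod 𝔔); and if there exist integers x, y with q = 2x² + 2xy + 9y², then ε^{(q−1)/2} ≡ −1 (mod 𝔔). -/
open NumberField IntermediateField

/-- The real quadratic field `ℚ(√17) ⊂ ℝ`. -/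
noncomputable def Qsqrt17 : IntermediateField ℚ ℝ := ℚ⟮(Real.sqrt 17 : ℝ)⟯

theorem not_sq_dvd_of_prime {p q : ℕ} (hq : q.Prime) (hp : p.Prime) : ¬ p ^ 2 ∣ q := fun h ↦
  hp.one_lt.ne' (Nat.isUnit_iff.1 (hq.prime.squarefree p (sq p ▸ h)))

theorem exists_odd_even_sq_add_sq {q : ℕ} [Fact q.Prime] (hq4 : q % 4 = 1) :
    ∃ a b : ℕ, q = a ^ 2 + b ^ 2 ∧ Odd a ∧ Even b := by
  obtain ⟨a, b, hab⟩ := Nat.Prime.sq_add_sq (p := q) (by omega)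
  have hodd : Odd (a ^ 2 + b ^ 2) := by rw [hab, Nat.odd_iff]; omega
  rcases Nat.even_or_odd a with ha | ha
  · refine ⟨b, a, by rw [← hab, add_comm], ?_, ha⟩
    have : Odd (b ^ 2) := (Nat.odd_add'.1 hodd).2 (ha.pow_of_ne_zero two_ne_zero)
    exact (Nat.odd_mul.1 (sq b ▸ this)).1
  · refine ⟨a, b, hab.symm, ha, ?_⟩
    exact (Nat.even_pow.1 ((Nat.odd_add.1 hodd).1 ha.pow)).1

theorem add_four_mul_ne_zero {q a b : ℕ} (hq : q.Prime) (hq17 : q ≠ 17)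
    (hab : q = a ^ 2 + b ^ 2) : ((a + 4 * b : ℤ) : ZMod 17) ≠ 0 := by
  intro h
  have e17 : (17 : ZMod 17) = 0 := CharP.cast_eq_zero (ZMod 17) 17
  have h17 : (q : ZMod 17) = 0 := by
    push_cast at h
    rw [hab]
    push_cast
    linear_combination (a - 4 * b : ZMod 17) * h + b ^ 2 * e17
  rw [ZMod.natCast_eq_zero_iff] at h17
  exact hq17 ((Nat.prime_dvd_prime_iff_eq (by norm_num) hq).1 h17).symm

/-- If `n` divides a value `B² - 17Y²` of the norm form of `ℤ[√17]`, and no odd prime divides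
`n`, the cofactor `m`, `B` and `Y` simultaneously, then `n` is a square modulo `17`. -/
theorem isSquare_zmod_seventeen_of_mul_eq (n m B Y : ℤ) (hn : ¬ (17 : ℤ) ∣ n)
    (h : n * m = B ^ 2 - 17 * Y ^ 2)
    (hp : ∀ p : ℕ, p.Prime → p ≠ 2 → (p : ℤ) ∣ n → (p : ℤ) ∣ m → (p : ℤ) ∣ B →
      (p : ℤ) ∣ Y → False) :
    IsSquare (n : ZMod 17) := by
  induction hk : n.natAbs using Nat.strong_induction_on generalizing n m B Y with
  | _ k ih =>
  subst hk
  have hn0 : n ≠ 0 := by rintro rfl; simp at hn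
  by_cases h1 : n.natAbs = 1
  · rcases Int.natAbs_eq_iff.1 h1 with rfl | rfl <;> decide
  obtain ⟨p, pp, hpn⟩ := Nat.exists_prime_and_dvd h1
  have hpn' : (p : ℤ) ∣ n := Int.natCast_dvd.2 hpn
  have ppz : Prime (p : ℤ) := Nat.prime_iff_prime_int.1 pp
  have lt_of_mul (c d : ℤ) (hd : 1 < d.natAbs) (hc : n = d * c) : c.natAbs < n.natAbs := by
    have : c ≠ 0 := by rintro rfl; simp [hc] at hn0
    rw [hc, Int.natAbs_mul]
    nlinarith [Int.natAbs_pos.2 this]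
  by_cases hBY : p ≠ 2 ∧ (p : ℤ) ∣ B ∧ (p : ℤ) ∣ Y
  · obtain ⟨hp2, ⟨B', rfl⟩, ⟨Y', rfl⟩⟩ := hBY
    have hpm : ¬ (p : ℤ) ∣ m := fun hm ↦
      hp p pp hp2 hpn' hm (dvd_mul_right _ _) (dvd_mul_right _ _)
    have hdvd : (p : ℤ) ^ 2 ∣ n * m := ⟨B' ^ 2 - 17 * Y' ^ 2, by rw [h]; ring⟩
    obtain ⟨c, hc⟩ := ppz.pow_dvd_of_dvd_mul_right 2 hpm hdvd
    have hc' : IsSquare (c : ZMod 17) := by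
      refine ih _ (lt_of_mul c _ ?_ hc) c m B' Y' ?_ ?_ ?_ rfl
      · rw [Int.natAbs_pow, Int.natAbs_natCast]; nlinarith [pp.two_le]
      · exact fun hd ↦ hn (hc ▸ hd.mul_left _)
      · apply mul_left_cancel₀ (pow_ne_zero 2 ppz.ne_zero)
        rw [← mul_assoc, ← hc, h]; ring
      · exact fun r hr hr2 h1 h2 h3 h4 ↦ hp r hr hr2 (hc ▸ h1.mul_left _) h2
          (h3.mul_left _) (h4.mul_left _)
    rw [hc]
    push_cast
    exact (IsSquare.sq _).mul hc'
  · obtain ⟨c, hc⟩ := hpn'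
    have hc' : IsSquare (c : ZMod 17) := by
      refine ih _ (lt_of_mul c _ (by simpa using pp.one_lt) hc) c (p * m) B Y ?_ ?_ ?_ rfl
      · exact fun hd ↦ hn (hc ▸ hd.mul_left _)
      · rw [← h, hc]; ring
      · intro r hr hr2 h1 h2 h3 h4
        rcases (Nat.prime_iff_prime_int.1 hr).dvd_or_dvd h2 with h5 | h5
        · have : r = p := (Nat.prime_dvd_prime_iff_eq hr pp).1 (Int.natCast_dvd_natCast.1 h5)
          subst this
          exact hBY ⟨hr2, h3, h4⟩
        · exact hp r hr hr2 (hc ▸ h1.mul_left _) h5 h3 h4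
    have hpsq : IsSquare (p : ZMod 17) := by
      by_cases hp2 : p = 2
      · subst hp2; exact ⟨6, by decide⟩
      have : Fact p.Prime := ⟨pp⟩
      have : Fact (Nat.Prime 17) := ⟨by norm_num⟩
      refine (ZMod.exists_sq_eq_prime_iff_of_mod_four_eq_one (p := 17) (by norm_num) hp2).2 ?_
      have hmod : (B : ZMod p) ^ 2 = 17 * (Y : ZMod p) ^ 2 := by
        have := congrArg (Int.cast : ℤ → ZMod p) h
        rw [hc] at this
        push_cast at this
        rw [CharP.cast_eq_zero] at this
        linear_combination -this
      by_cases hY : (Y : ZMod p) = 0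
      · have hB : (B : ZMod p) = 0 := by simpa [hY] using hmod
        exact absurd ⟨hp2, (ZMod.intCast_zmod_eq_zero_iff_dvd _ _).1 hB,
          (ZMod.intCast_zmod_eq_zero_iff_dvd _ _).1 hY⟩ hBY
      · refine ⟨(B : ZMod p) / Y, ?_⟩
        push_cast
        field_simp
        exact hmod.symm
    rw [hc]
    push_cast
    exact hpsq.mul hc'

/-- If `A² + B²` is represented by `X² + 17Y²`, then `A + 4B`, the reduction of `A + iB` at a
prime of `ℤ[i]` above `17`, is a square modulo `17`. -/
theorem isSquare_zmod_seventeen_add_four_mul (A B X Y : ℤ)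
    (h : A ^ 2 + B ^ 2 = X ^ 2 + 17 * Y ^ 2) (h17 : ¬ (17 : ℤ) ∣ A ^ 2 + B ^ 2)
    (hp : ∀ p : ℕ, p.Prime → p ≠ 2 → ¬ (p : ℤ) ^ 2 ∣ A ^ 2 + B ^ 2) :
    IsSquare ((A + 4 * B : ℤ) : ZMod 17) := by
  have h6 : (6 : ZMod 17) ≠ 0 := by decide
  have : Fact (Nat.Prime 17) := ⟨by norm_num⟩
  wlog hn : ¬ (17 : ℤ) ∣ A + X generalizing X
  · refine this (-X) (by rw [h]; ring) fun hn' ↦ h17 ?_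
    rw [not_not] at hn
    have hA : (17 : ℤ) ∣ A := by omega
    have hX : (17 : ℤ) ∣ X := by omega
    rw [h]
    exact dvd_add (dvd_pow hX two_ne_zero) (dvd_mul_right _ _)
  have hsq := isSquare_zmod_seventeen_of_mul_eq (A + X) (X - A) B Y hn
    (by linear_combination -h) ?_
  · obtain ⟨r, hr⟩ := hsq
    have hr0 : r ≠ 0 := by
      rintro rfl
      exact hn ((ZMod.intCast_zmod_eq_zero_iff_dvd _ 17).1 (by simpa using hr))
    have h' := congrArg (Int.cast : ℤ → ZMod 17) h
    have e17 : (17 : ZMod 17) = 0 := CharP.cast_eq_zero (ZMod 17) 17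
    push_cast at h' hr ⊢
    refine ⟨(A + X + 4 * B) / (6 * r), ?_⟩
    field_simp
    linear_combination h' - 36 * (A + 4 * B) * hr +
      (Y ^ 2 - B ^ 2 + 2 * (A + X) * (A + 4 * B)) * e17
  · intro p pp hp2 h1 h2 h3 h4
    have ppz : Prime (p : ℤ) := Nat.prime_iff_prime_int.1 pp
    have h2' : ¬ (p : ℤ) ∣ 2 := fun hd ↦
      hp2 ((Nat.prime_dvd_prime_iff_eq pp Nat.prime_two).1 (by exact_mod_cast hd))
    have hA : (p : ℤ) ∣ 2 * A := by
      have := dvd_sub h1 h2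
      rwa [show A + X - (X - A) = 2 * A by ring] at this
    exact hp p pp hp2 (dvd_add (pow_dvd_pow_of_dvd ((ppz.dvd_or_dvd hA).resolve_left h2') 2)
      (pow_dvd_pow_of_dvd h3 2))

theorem jacobiSym_two_mul_eq_one {q a b : ℕ} (hq : q.Prime) (hq4 : q % 4 = 1)
    (hab : q = a ^ 2 + b ^ 2) (hb : Even b) (hb0 : b ≠ 0) :
    jacobiSym (2 * b : ℕ) q = 1 := by
  obtain ⟨c, rfl⟩ := hb
  have hcop : a.Coprime c := by
    refine Nat.coprime_of_dvd fun p pp hpa hpc ↦ ?_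
    have : p ^ 2 ∣ q := by
      rw [hab]
      exact dvd_add (pow_dvd_pow_of_dvd hpa 2) (pow_dvd_pow_of_dvd (hpc.add hpc) 2)
    exact not_sq_dvd_of_prime hq pp this
  have hq2 : Odd q := Nat.odd_iff.2 (by omega)
  have hc0 : c ≠ 0 := by omega
  have h2 : jacobiSym 2 q ^ 2 = 1 := by
    apply jacobiSym.sq_one
    exact_mod_cast Nat.coprime_two_left.2 hq2
  obtain ⟨k, c', hc', rfl⟩ := Nat.exists_eq_two_pow_mul_odd hc0
  have hodd : jacobiSym c' q = 1 := by
    rw [jacobiSym.quadratic_reciprocity_one_mod_four' hc' hq4]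
    have : (q : ℤ) % c' = (a : ℤ) ^ 2 % c' := by
      rw [hab]
      push_cast
      exact Int.ModEq.symm (Int.modEq_iff_dvd.2 ⟨c' * (2 ^ k + 2 ^ k) ^ 2, by ring⟩)
    rw [jacobiSym.mod_left' this]
    apply jacobiSym.sq_one'
    exact_mod_cast Nat.Coprime.coprime_mul_left_right hcop
  have hk : jacobiSym 2 q ^ k = 1 := by
    rcases k with _ | k
    · simp
    · have h8 : q % 8 = 1 := by
        have ha : a % 2 = 1 := by
          by_contra h
          have : q % 2 = 0 := by
            rw [hab, Nat.add_mod, Nat.pow_mod, Nat.pow_mod (_ + _)]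
            rw [show a % 2 = 0 by omega,
              show (2 ^ (k + 1) * c' + 2 ^ (k + 1) * c') % 2 = 0 by omega]
          omega
        have h4 : 2 ^ (k + 1) * c' + 2 ^ (k + 1) * c' = 4 * (2 ^ k * c') := by ring
        rw [hab, h4, Nat.add_mod, mul_pow, Nat.mul_mod, Nat.pow_mod a]
        have : a % 8 = 1 ∨ a % 8 = 3 ∨ a % 8 = 5 ∨ a % 8 = 7 := by omega
        rcases this with h | h | h | h <;> simp [h]
      rw [jacobiSym.at_two hq2, ZMod.χ₈_nat_mod_eight, h8]
      simp
  have e : ((2 * (2 ^ k * c' + 2 ^ k * c') : ℕ) : ℤ) = 2 * 2 * (2 ^ k * c') := by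
    push_cast; ring
  rw [e, jacobiSym.mul_left, jacobiSym.mul_left, jacobiSym.mul_left, jacobiSym.pow_left, hodd, hk,
    ← sq, h2]
  norm_num

theorem jacobiSym_four_mul_add {q a b : ℕ} (hq : q.Prime) (hq4 : q % 4 = 1)
    (hab : q = a ^ 2 + b ^ 2) (ha : Odd a) :
    jacobiSym (4 * b + a : ℕ) q = jacobiSym (4 * b + a : ℕ) 17 := by
  have hn : Odd (4 * b + a) := Even.add_odd ⟨2 * b, by ring⟩ ha
  have h2n : (4 : ℤ).gcd (4 * b + a : ℕ) = 1 := by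
    have : (2 ^ 2).Coprime (4 * b + a) := (Nat.coprime_two_left.2 hn).pow_left 2
    exact_mod_cast this
  have hcop : a.Coprime (4 * b + a) := by
    refine Nat.coprime_of_dvd fun p pp hpa hpn ↦ ?_
    have hp2 : p ≠ 2 := by
      rintro rfl
      exact Nat.not_even_iff_odd.2 ha (even_iff_two_dvd.2 hpa)
    have h4b : p ∣ 2 ^ 2 * b := (Nat.dvd_add_left hpa).1 hpn
    have hpb : p ∣ b := (pp.dvd_mul.1 h4b).resolve_left fun h ↦
      hp2 ((Nat.prime_dvd_prime_iff_eq pp Nat.prime_two).1 (pp.dvd_of_dvd_pow h))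
    have : p ^ 2 ∣ q := by
      rw [hab]
      exact dvd_add (pow_dvd_pow_of_dvd hpa 2) (pow_dvd_pow_of_dvd hpb 2)
    exact not_sq_dvd_of_prime hq pp this
  rw [jacobiSym.quadratic_reciprocity_one_mod_four' hn hq4,
    jacobiSym.quadratic_reciprocity_one_mod_four' hn (b := 17) (by norm_num)]
  have hmod : (4 ^ 2 * q : ℤ) % (4 * b + a : ℕ) = (17 : ℕ) * a ^ 2 % (4 * b + a : ℕ) := by
    refine Int.ModEq.symm (Int.modEq_iff_dvd.2 ⟨4 * b - a, ?_⟩)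
    rw [hab]
    push_cast
    ring
  have := jacobiSym.mod_left' hmod
  rwa [jacobiSym.mul_left, jacobiSym.mul_left, jacobiSym.sq_one' h2n,
    jacobiSym.sq_one' (by exact_mod_cast hcop), one_mul, mul_one] at this

/-- The quadratic character of `4 + √17` modulo `q = a² + b²` is that of `4b + a` modulo `17`. -/
theorem pow_eq_legendreSym_seventeen {q a b : ℕ} [Fact q.Prime] [Fact (Nat.Prime 17)]
    (hq4 : q % 4 = 1) (hq17 : q ≠ 17) (hab : q = a ^ 2 + b ^ 2) (ha : Odd a) (hb : Even b)
    (s : ZMod q) (hs : s ^ 2 = 17) :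
    (4 + s) ^ (q / 2) = ((legendreSym 17 (4 * b + a : ℕ) : ℤ) : ZMod q) := by
  have hq : q.Prime := Fact.out
  have hb0 : b ≠ 0 := by
    rintro rfl
    have : a ∣ q := ⟨a, by rw [hab]; ring⟩
    rcases (Nat.dvd_prime hq).1 this with rfl | rfl
    · exact hq.ne_one (by simpa using hab)
    · nlinarith [hq.one_lt]
  have h1 : jacobiSym (2 * b * (4 * b + a) : ℕ) q = legendreSym 17 (4 * b + a : ℕ) := by
    rw [Nat.cast_mul, jacobiSym.mul_left, jacobiSym_two_mul_eq_one hq hq4 hab hb hb0,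
      jacobiSym_four_mul_add hq hq4 hab ha, one_mul, jacobiSym.legendreSym.to_jacobiSym]
  rw [← jacobiSym.legendreSym.to_jacobiSym] at h1
  have h0 : (a : ZMod q) ^ 2 + b ^ 2 = 0 := by
    have := congrArg (Nat.cast : ℕ → ZMod q) hab
    push_cast at this
    rw [← this, CharP.cast_eq_zero]
  have hsq : (2 * b * (4 * b + a)) * (4 + s) = (4 * b + a + s * b : ZMod q) ^ 2 := by
    linear_combination -h0 - (b : ZMod q) ^ 2 * hs
  have hne : legendreSym q (2 * b * (4 * b + a) : ℕ) ≠ 0 := by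
    rw [h1, Ne, legendreSym.eq_zero_iff]
    have := add_four_mul_ne_zero hq hq17 hab
    rw [add_comm] at this
    exact_mod_cast this
  have hne' : (2 * b * (4 * b + a) : ZMod q) ≠ 0 := by
    rw [Ne, legendreSym.eq_zero_iff] at hne
    exact_mod_cast hne
  have h4s : (4 + s : ZMod q) ≠ 0 := by
    intro h
    have : (1 : ZMod q) = 0 := by linear_combination (s - 4) * h - hs
    exact one_ne_zero this
  have hw : (4 * b + a + s * b : ZMod q) ≠ 0 := fun h ↦
    mul_ne_zero hne' h4s (by rw [hsq, h, zero_pow two_ne_zero])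
  have hL := legendreSym.eq_pow q (2 * b * (4 * b + a) : ℕ)
  rw [h1] at hL
  have hone : (2 * b * (4 * b + a) : ZMod q) ^ (q / 2) * (4 + s) ^ (q / 2) = 1 := by
    rw [← mul_pow, hsq, ← pow_mul, show 2 * (q / 2) = q - 1 by omega,
      ZMod.pow_card_sub_one_eq_one hw]
  push_cast at hL
  push_cast
  rw [← hL] at hone
  rw [h1] at hne
  rcases legendreSym.eq_one_or_neg_one 17 (a := ((4 * b + a : ℕ) : ℤ))
    (fun h ↦ hne ((legendreSym.eq_zero_iff _ _).2 h)) with h | h <;>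
  · push_cast at h
    rw [h] at hone ⊢
    push_cast at hone ⊢
    simpa [neg_eq_iff_eq_neg] using hone

theorem pow_eq_one_of_eq_sq_add {q : ℕ} [Fact q.Prime] (hq4 : q % 4 = 1) (s : ZMod q)
    (hs : s ^ 2 = 17) (x y : ℤ) (h : (q : ℤ) = x ^ 2 + 17 * y ^ 2) :
    (4 + s) ^ (q / 2) = 1 := by
  have hq : q.Prime := Fact.out
  by_cases hq17 : q = 17
  · subst hq17
    have hs0 : s = 0 := by
      have : s ^ 2 = 0 := hs.trans (CharP.cast_eq_zero (ZMod 17) 17)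
      exact pow_eq_zero_iff two_ne_zero |>.1 this
    rw [hs0]
    decide +revert
  have : Fact (Nat.Prime 17) := ⟨by norm_num⟩
  obtain ⟨a, b, hab, ha, hb⟩ := exists_odd_even_sq_add_sq hq4
  rw [pow_eq_legendreSym_seventeen hq4 hq17 hab ha hb s hs]
  have hab' : (q : ℤ) = a ^ 2 + b ^ 2 := by exact_mod_cast hab
  have h17 : ¬ (17 : ℤ) ∣ q := fun hd ↦
    hq17 ((Nat.prime_dvd_prime_iff_eq Fact.out hq).1 (Int.natCast_dvd_natCast.1 hd)).symm
  have hsq := isSquare_zmod_seventeen_add_four_mul a b x y (by rw [← hab', h])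
    (by rwa [← hab']) (fun p pp _ hd ↦ by
      rw [← hab'] at hd
      exact not_sq_dvd_of_prime hq pp (by exact_mod_cast hd))
  have e : ((4 * b + a : ℕ) : ℤ) = a + 4 * b := by push_cast; ring
  rw [e, (legendreSym.eq_one_iff 17 (add_four_mul_ne_zero hq hq17 hab)).2 hsq]
  simp

theorem pow_eq_neg_one_of_eq_two_mul_sq_add {q : ℕ} [Fact q.Prime] (hq4 : q % 4 = 1)
    (s : ZMod q) (hs : s ^ 2 = 17) (x y : ℤ)
    (h : (q : ℤ) = 2 * x ^ 2 + 2 * x * y + 9 * y ^ 2) :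
    (4 + s) ^ (q / 2) = -1 := by
  have hq : q.Prime := Fact.out
  have h2 : 2 * (q : ℤ) = (2 * x + y) ^ 2 + 17 * y ^ 2 := by rw [h]; ring
  have hq17 : q ≠ 17 := by
    rintro rfl
    push_cast at h h2
    have h1 : y ≤ 1 := by nlinarith [sq_nonneg (2 * x + y)]
    have h1' : -1 ≤ y := by nlinarith [sq_nonneg (2 * x + y)]
    have h3 : x ≤ 3 := by nlinarith [sq_nonneg y]
    have h3' : -3 ≤ x := by nlinarith [sq_nonneg y]
    interval_cases y <;> interval_cases x <;> omega
  have n3 : ¬ IsSquare (-3 : ZMod 17) := by decide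
  have : Fact (Nat.Prime 17) := ⟨by norm_num⟩
  obtain ⟨a, b, hab, ha, hb⟩ := exists_odd_even_sq_add_sq hq4
  rw [pow_eq_legendreSym_seventeen hq4 hq17 hab ha hb s hs]
  have hab' : 2 * (q : ℤ) = (a + b) ^ 2 + (b - a) ^ 2 := by rw [hab]; push_cast; ring
  have h17 : ¬ (17 : ℤ) ∣ 2 * q := fun hd ↦ by
    have : 17 ∣ q := by omega
    exact hq17 ((Nat.prime_dvd_prime_iff_eq Fact.out hq).1 this).symm
  have hsq := isSquare_zmod_seventeen_add_four_mul (a + b) (b - a) (2 * x + y) y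
    (by rw [← hab', h2]) (by rwa [← hab']) (fun p pp hp2 hd ↦ by
      rw [← hab'] at hd
      have hd' : p ^ 2 ∣ 2 * q := by exact_mod_cast hd
      exact not_sq_dvd_of_prime hq pp
        ((((Nat.coprime_primes pp Nat.prime_two).2 hp2).pow_left 2).dvd_of_dvd_mul_left hd'))
  have e17 : (17 : ZMod 17) = 0 := CharP.cast_eq_zero (ZMod 17) 17
  have hne := add_four_mul_ne_zero hq hq17 hab
  have e : ((4 * b + a : ℕ) : ℤ) = a + 4 * b := by push_cast; ring
  have key : ¬ IsSquare ((a + 4 * b : ℤ) : ZMod 17) := fun hsq' ↦ by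
    apply n3
    have : (-3 : ZMod 17) =
        ((a + b + 4 * (b - a) : ℤ) : ZMod 17) / ((a + 4 * b : ℤ) : ZMod 17) := by
      rw [eq_div_iff hne]
      push_cast
      linear_combination (-b : ZMod 17) * e17
    rw [this]
    exact hsq.div hsq'
  rw [e, (legendreSym.eq_neg_one_iff 17).2 key]
  simp

/-- Dirichlet's example: for the unit `ε = 4 + √17` of `ℚ(√17)` and a prime `q ≡ 1 mod 4`
with `(17/q) = 1`, one has `(ε/q) = +1` if `q = x² + 17y²` and `(ε/q) = -1` if
`q = 2x² + 2xy + 9y²`. -/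
theorem quadratic_character_of_unit_sqrt17
    [NumberField Qsqrt17]
    (ε : 𝓞 Qsqrt17) (hε : ((ε : Qsqrt17) : ℝ) = 4 + Real.sqrt 17)
    (q : ℕ) (hq : q.Prime) (hq4 : q % 4 = 1) (hq17 : IsSquare ((17 : ZMod q)))
    (𝔔 : Ideal (𝓞 Qsqrt17)) (h𝔔 : 𝔔.IsPrime) (h𝔔q : ((q : ℕ) : 𝓞 Qsqrt17) ∈ 𝔔) :
    ((∃ x y : ℤ, (q : ℤ) = x ^ 2 + 17 * y ^ 2) →
      (ε ^ ((q - 1) / 2) - 1 ∈ 𝔔)) ∧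
    ((∃ x y : ℤ, (q : ℤ) = 2 * x ^ 2 + 2 * x * y + 9 * y ^ 2) →
      (ε ^ ((q - 1) / 2) + 1 ∈ 𝔔)) := by
  have : Fact q.Prime := ⟨hq⟩
  obtain ⟨s, hs⟩ := hq17
  rw [← sq] at hs
  have hε2 : ε ^ 2 = 8 * ε + 1 := by
    let f : 𝓞 Qsqrt17 →+* ℝ := (algebraMap Qsqrt17 ℝ).comp (algebraMap (𝓞 Qsqrt17) Qsqrt17)
    have hf : Function.Injective f :=
      (algebraMap Qsqrt17 ℝ).injective.comp RingOfIntegers.coe_injective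
    have hfε : f ε = 4 + Real.sqrt 17 := hε
    have h17 : Real.sqrt 17 ^ 2 = 17 := Real.sq_sqrt (by norm_num)
    apply hf
    rw [map_pow, map_add, map_mul, map_one, map_ofNat, hfε]
    linear_combination h17
  let π := Ideal.Quotient.mk 𝔔
  have hchar : (q : 𝓞 Qsqrt17 ⧸ 𝔔) = 0 := by
    rw [← map_natCast π]
    exact Ideal.Quotient.eq_zero_iff_mem.2 h𝔔q
  let φ : ZMod q →+* 𝓞 Qsqrt17 ⧸ 𝔔 := ZMod.castHom (ringChar.dvd hchar) _
  have hφs : φ s ^ 2 = 17 := by rw [← map_pow, ← hs, map_ofNat]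
  obtain ⟨t, ht, hπε⟩ : ∃ t : ZMod q, t ^ 2 = 17 ∧ π ε = φ (4 + t) := by
    have hroot : (π ε - φ (4 + s)) * (π ε - φ (4 + -s)) = 0 := by
      have := congrArg π hε2
      simp only [map_pow, map_add, map_mul, map_one, map_ofNat, map_neg] at this ⊢
      linear_combination this - hφs
    rcases mul_eq_zero.1 hroot with h | h
    · exact ⟨s, hs.symm, sub_eq_zero.1 h⟩
    · exact ⟨-s, by rw [neg_sq, hs], sub_eq_zero.1 h⟩
  have hexp : (q - 1) / 2 = q / 2 := by omega
  rw [hexp]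
  refine ⟨fun ⟨x, y, h⟩ ↦ ?_, fun ⟨x, y, h⟩ ↦ ?_⟩ <;> apply Ideal.Quotient.eq_zero_iff_mem.1
  · change π (ε ^ (q / 2) - 1) = 0
    rw [map_sub, map_pow, hπε, ← map_pow, pow_eq_one_of_eq_sq_add hq4 t ht x y h]
    simp
  · change π (ε ^ (q / 2) + 1) = 0
    rw [map_add, map_pow, hπε, ← map_pow, pow_eq_neg_one_of_eq_two_mul_sq_add hq4 t ht x y h]
    simp
end

section
/- Let p be a prime with p ≡ 1 (mod 8), let a, b be integers with p = a² + 4b², and let ε > 1 be the fundamental unit of ℚ(√p) ⊂ ℝ. Then (a + 2bi)·ε is a square in the number field ℚ(i, √p) ⊂ ℂ, i.e., there exists μ ∈ ℚ(i, √p) with μ² = (a + 2bi)·ε. -/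
open NumberField IntermediateField

/-- The real quadratic field `ℚ(√p) ⊂ ℝ`. -/
noncomputable def Qsqrt (p : ℕ) : IntermediateField ℚ ℝ := ℚ⟮(Real.sqrt p : ℝ)⟯

/-- The field `ℚ(i, √p) ⊂ ℂ`. -/
noncomputable def QiSqrt (p : ℕ) : IntermediateField ℚ ℂ :=
  ℚ⟮Complex.I, ((Real.sqrt p : ℝ) : ℂ)⟯

lemma Int.sq_emod_eight_of_odd {n : ℤ} (h : Odd n) : n ^ 2 % 8 = 1 := by
  obtain ⟨c, rfl⟩ := h
  obtain ⟨d, hd⟩ := Int.even_mul_succ_self c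
  have : (2 * c + 1) ^ 2 = 8 * d + 1 := by linear_combination 4 * hd
  omega

lemma sqrt_mem_Qsqrt (p : ℕ) : √(p : ℝ) ∈ Qsqrt p := mem_adjoin_simple_self ℚ _

lemma exists_rat_of_mem_Qsqrt {p : ℕ} {z : ℝ} (hz : z ∈ Qsqrt p) :
    ∃ r s : ℚ, z = r + s * √(p : ℝ) := by
  have hsq : √(p : ℝ) ^ 2 = p := Real.sq_sqrt (Nat.cast_nonneg p)
  unfold Qsqrt at hz
  induction hz using adjoin_induction with
  | mem x hx =>
    rw [Set.mem_singleton_iff] at hx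
    exact ⟨0, 1, by simp [hx]⟩
  | algebraMap q => exact ⟨q, 0, by simp⟩
  | add x y _ _ hx hy =>
    obtain ⟨r, s, rfl⟩ := hx
    obtain ⟨r', s', rfl⟩ := hy
    exact ⟨r + r', s + s', by push_cast; ring⟩
  | mul x y _ _ hx hy =>
    obtain ⟨r, s, rfl⟩ := hx
    obtain ⟨r', s', rfl⟩ := hy
    exact ⟨r * r' + p * s * s', r * s' + s * r', by push_cast; linear_combination s * s' * hsq⟩
  | inv x _ hx =>
    obtain ⟨r, s, rfl⟩ := hx
    by_cases h : (r : ℝ) - s * √(p : ℝ) = 0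
    · exact ⟨(2 * r)⁻¹, 0, by push_cast; rw [zero_mul, add_zero]; congr 1; linear_combination -h⟩
    by_cases h0 : (r : ℝ) + s * √(p : ℝ) = 0
    · exact ⟨0, 0, by simp [h0]⟩
    have hN : (r : ℝ) ^ 2 - p * s ^ 2 = (r + s * √(p : ℝ)) * (r - s * √(p : ℝ)) := by
      linear_combination s ^ 2 * hsq
    refine ⟨r / (r ^ 2 - p * s ^ 2), -s / (r ^ 2 - p * s ^ 2), ?_⟩
    push_cast
    rw [hN]
    field_simp
    ring

lemma exists_conj_Qsqrt {p : ℕ} (hp : p.Prime) :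
    ∃ σ : Qsqrt p →ₐ[ℚ] ℝ, ∀ (z : Qsqrt p) (r s : ℚ), (z : ℝ) = r + s * √(p : ℝ) →
      σ z = r - s * √(p : ℝ) := by
  have hsq : √(p : ℝ) ^ 2 = p := Real.sq_sqrt (Nat.cast_nonneg p)
  have hmonic : (Polynomial.X ^ 2 - Polynomial.C (p : ℚ)).Monic :=
    Polynomial.monic_X_pow_sub_C _ two_ne_zero
  have hirr : Irreducible (Polynomial.X ^ 2 - Polynomial.C (p : ℚ)) := by
    refine X_pow_sub_C_irreducible_of_prime Nat.prime_two fun q hq => ?_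
    refine hp.irrational_sqrt ⟨|q|, ?_⟩
    have : (p : ℝ) = (q : ℝ) ^ 2 := by exact_mod_cast hq.symm
    rw [this, Real.sqrt_sq_eq_abs, Rat.cast_abs]
  have hmin : minpoly ℚ √(p : ℝ) = Polynomial.X ^ 2 - Polynomial.C (p : ℚ) :=
    (minpoly.eq_of_irreducible_of_monic hirr (by simp [hsq]) hmonic).symm
  have hint : IsIntegral ℚ √(p : ℝ) := ⟨_, hmonic, by simp [hsq]⟩
  let σ := (algHomAdjoinIntegralEquiv ℚ (K := ℝ) hint).symm ⟨-√(p : ℝ), by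
    rw [hmin, Polynomial.mem_aroots]
    exact ⟨hmonic.ne_zero, by simp [hsq]⟩⟩
  have hσ : σ (AdjoinSimple.gen ℚ √(p : ℝ)) = -√(p : ℝ) :=
    algHomAdjoinIntegralEquiv_symm_apply_gen ℚ hint _
  refine ⟨σ, fun z r s hz => ?_⟩
  have hz' : z = (algebraMap ℚ ℚ⟮√(p : ℝ)⟯ r +
      algebraMap ℚ ℚ⟮√(p : ℝ)⟯ s * AdjoinSimple.gen ℚ √(p : ℝ) : ℚ⟮√(p : ℝ)⟯) :=
    Subtype.ext hz
  have hσz : σ (algebraMap ℚ ℚ⟮√(p : ℝ)⟯ r +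
      algebraMap ℚ ℚ⟮√(p : ℝ)⟯ s * AdjoinSimple.gen ℚ √(p : ℝ)) = r - s * √(p : ℝ) := by
    rw [map_add, map_mul, hσ]
    simp only [eq_ratCast, map_ratCast]
    ring
  rw [hz']
  exact hσz

lemma exists_int_of_isIntegral_ratCast {q : ℚ} (h : IsIntegral ℤ (q : ℝ)) : ∃ n : ℤ, (n : ℚ) = q := by
  have : IsIntegral ℤ q := by
    rw [← isIntegral_algebraMap_iff (B := ℝ) (algebraMap ℚ ℝ).injective]
    exact h
  simpa using IsIntegrallyClosed.isIntegral_iff.1 this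

/-- For `p ≡ 1 mod 8`, the units of `𝓞 (Qsqrt p)` have the form `x + y √p` with `x² - p y² = ±1`. -/
lemma exists_pell_of_unit {p : ℕ} (hp : p.Prime) (hp8 : p % 8 = 1) (u : (𝓞 (Qsqrt p))ˣ) :
    ∃ x y : ℤ, (((u : 𝓞 (Qsqrt p)) : Qsqrt p) : ℝ) = x + y * √(p : ℝ) ∧
      (x ^ 2 - p * y ^ 2 = 1 ∨ x ^ 2 - p * y ^ 2 = -1) := by
  have hsq : √(p : ℝ) ^ 2 = p := Real.sq_sqrt (Nat.cast_nonneg p)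
  obtain ⟨σ, hσ⟩ := exists_conj_Qsqrt hp
  have key : ∀ w : 𝓞 (Qsqrt p), ∃ r s : ℚ, ((w : Qsqrt p) : ℝ) = r + s * √(p : ℝ) ∧
      σ w = r - s * √(p : ℝ) ∧ (∃ t : ℤ, (t : ℚ) = 2 * r) ∧ ∃ m : ℤ, (m : ℚ) = r ^ 2 - p * s ^ 2 := by
    intro w
    obtain ⟨r, s, h⟩ := exists_rat_of_mem_Qsqrt (w : Qsqrt p).2
    have hc := hσ _ r s h
    have h1 : IsIntegral ℤ ((w : Qsqrt p) : ℝ) :=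
      (RingOfIntegers.isIntegral_coe w).map ((Qsqrt p).val.restrictScalars ℤ)
    have h2 : IsIntegral ℤ (σ w) :=
      (RingOfIntegers.isIntegral_coe w).map (σ.restrictScalars ℤ)
    rw [h] at h1
    rw [hc] at h2
    refine ⟨r, s, h, hc, exists_int_of_isIntegral_ratCast ?_, exists_int_of_isIntegral_ratCast ?_⟩
    · have e : ((2 * r : ℚ) : ℝ) = (r + s * √(p : ℝ)) + (r - s * √(p : ℝ)) := by
        push_cast; ring
      rw [e]
      exact h1.add h2
    · have e : ((r ^ 2 - p * s ^ 2 : ℚ) : ℝ) = (r + s * √(p : ℝ)) * (r - s * √(p : ℝ)) := by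
        push_cast; linear_combination (s : ℝ) ^ 2 * hsq
      rw [e]
      exact h1.mul h2
  obtain ⟨r, s, h, hc, ⟨t, ht⟩, m, hm⟩ := key u
  obtain ⟨r', s', h', hc', -, m', hm'⟩ := key (u⁻¹ : (𝓞 (Qsqrt p))ˣ)
  have hmm : m * m' = 1 := by
    have e : ((u : 𝓞 (Qsqrt p)) : Qsqrt p) * ((u⁻¹ : (𝓞 (Qsqrt p))ˣ) : 𝓞 (Qsqrt p)) = 1 := by
      have := congrArg (algebraMap (𝓞 (Qsqrt p)) (Qsqrt p)) (Units.mul_inv u)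
      simpa only [map_mul, map_one] using this
    have e1 := congrArg (fun z : Qsqrt p => (z : ℝ)) e
    have e2 := congrArg σ e
    simp only [map_mul, map_one, hc, hc', MulMemClass.coe_mul, h, h', OneMemClass.coe_one] at e1 e2
    have hmR : (m : ℝ) = r ^ 2 - p * s ^ 2 := by exact_mod_cast congrArg (Rat.cast : ℚ → ℝ) hm
    have hmR' : (m' : ℝ) = r' ^ 2 - p * s' ^ 2 := by exact_mod_cast congrArg (Rat.cast : ℚ → ℝ) hm'
    have : (m : ℝ) * m' = 1 := by
      rw [hmR, hmR', ← hsq]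
      linear_combination e1 * ((r - s * √(p : ℝ)) * (r' - s' * √(p : ℝ))) + e2
    exact_mod_cast this
  have hm1 : m = 1 ∨ m = -1 := Int.isUnit_iff.1 (IsUnit.of_mul_eq_one _ hmm)
  have hpZ : Prime (p : ℤ) := Nat.prime_iff_prime_int.1 hp
  have hp0 : (p : ℚ) ≠ 0 := by exact_mod_cast hp.ne_zero
  obtain ⟨n, hn⟩ : ∃ n : ℤ, (n : ℚ) = p * (2 * s) := by
    have : IsIntegral ℤ ((p : ℚ) * (2 * s)) := by
      refine IsIntegral.of_pow two_pos ?_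
      have : ((p : ℚ) * (2 * s)) ^ 2 = ((p * (t ^ 2 - 4 * m) : ℤ) : ℚ) := by
        push_cast; rw [ht, hm]; ring
      rw [this]
      exact isIntegral_algebraMap
    simpa using IsIntegrallyClosed.isIntegral_iff.1 this
  have hn2 : n ^ 2 = p * (t ^ 2 - 4 * m) := by
    have : (n : ℚ) ^ 2 = p * (t ^ 2 - 4 * m) := by rw [hn, ht, hm]; ring
    exact_mod_cast this
  obtain ⟨v, rfl⟩ : (p : ℤ) ∣ n := hpZ.dvd_of_dvd_pow ⟨_, hn2⟩
  have hv : (v : ℚ) = 2 * s := by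
    push_cast at hn
    exact mul_left_cancel₀ hp0 hn
  have hN : t ^ 2 - p * v ^ 2 = 4 * m := by
    have : (t : ℚ) ^ 2 - p * v ^ 2 = 4 * m := by rw [hv, ht, hm]; ring
    exact_mod_cast this
  obtain ⟨k, hk⟩ : ∃ k : ℤ, (p : ℤ) = 8 * k + 1 := ⟨p / 8, by omega⟩
  have hpar : Even t ∧ Even v := by
    rcases Int.even_or_odd t with h1 | h1 <;> rcases Int.even_or_odd v with h2 | h2
    · exact ⟨h1, h2⟩
    · exfalso
      obtain ⟨c, rfl⟩ := h1
      obtain ⟨d, rfl⟩ := h2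
      rw [hk] at hN
      ring_nf at hN
      omega
    · exfalso
      obtain ⟨c, rfl⟩ := h1
      obtain ⟨d, rfl⟩ := h2
      rw [hk] at hN
      ring_nf at hN
      omega
    · exfalso
      have h3 : t ^ 2 % 8 = 1 := Int.sq_emod_eight_of_odd h1
      have h4 : v ^ 2 % 8 = 1 := Int.sq_emod_eight_of_odd h2
      have : t ^ 2 - v ^ 2 = 8 * (k * v ^ 2) + 4 * m := by rw [← hN, hk]; ring
      omega
  obtain ⟨⟨x, rfl⟩, y, rfl⟩ := hpar
  refine ⟨x, y, ?_, ?_⟩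
  · have hx : (x : ℚ) = r := by push_cast at ht; linarith
    have hy : (y : ℚ) = s := by push_cast at hv; linarith
    rw [h, ← hx, ← hy]
    push_cast; rfl
  · have : x ^ 2 - p * y ^ 2 = m := by linarith
    rwa [this]

lemma exists_unit_of_pell {p : ℕ} {x y m : ℤ} (hm : m = 1 ∨ m = -1) (h : x ^ 2 - p * y ^ 2 = m) :
    ∃ u : (𝓞 (Qsqrt p))ˣ, (((u : 𝓞 (Qsqrt p)) : Qsqrt p) : ℝ) = x + y * √(p : ℝ) := by
  have hsq : √(p : ℝ) ^ 2 = p := Real.sq_sqrt (Nat.cast_nonneg p)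
  obtain ⟨g, hgR⟩ : ∃ g : 𝓞 (Qsqrt p), ((g : Qsqrt p) : ℝ) = √(p : ℝ) := by
    refine ⟨⟨⟨√(p : ℝ), sqrt_mem_Qsqrt p⟩, IsIntegral.of_pow two_pos ?_⟩, rfl⟩
    have : (⟨√(p : ℝ), sqrt_mem_Qsqrt p⟩ : Qsqrt p) ^ 2 = algebraMap ℤ _ (p : ℤ) :=
      Subtype.ext (by simp [hsq])
    rw [this]
    exact isIntegral_algebraMap
  have hg : g ^ 2 = (p : ℤ) := by
    apply RingOfIntegers.ext
    apply Subtype.ext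
    simp [hgR, hsq]
  have hm2 : (m : 𝓞 (Qsqrt p)) ^ 2 = 1 := by
    rcases hm with rfl | rfl <;> simp
  have hN : (x : 𝓞 (Qsqrt p)) ^ 2 - g ^ 2 * (y : 𝓞 (Qsqrt p)) ^ 2 = m := by
    rw [hg, ← h]; push_cast; ring
  refine ⟨Units.mkOfMulEqOne (x + y * g) (m * (x - y * g)) ?_, ?_⟩
  · linear_combination (m : 𝓞 (Qsqrt p)) * hN + hm2
  · simp [hgR]

/-- If `x² - p y² = 1` with `1 < x`, then `x + y √p = (u + v √p)²` with `u² - p v² = ±1`. -/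
lemma exists_sqrt_of_pell {p : ℕ} (hp : p.Prime) (hp8 : p % 8 = 1) {x y : ℤ} (hx : 1 < x)
    (h : x ^ 2 - p * y ^ 2 = 1) :
    ∃ u v m : ℤ, (m = 1 ∨ m = -1) ∧ u ^ 2 - p * v ^ 2 = m ∧ u ^ 2 + p * v ^ 2 = x ∧
      2 * u * v = y := by
  obtain ⟨k, hk⟩ : ∃ k : ℤ, (p : ℤ) = 8 * k + 1 := ⟨p / 8, by omega⟩
  have hpZ : Prime (p : ℤ) := Nat.prime_iff_prime_int.1 hp
  have hp0 : (p : ℤ) ≠ 0 := hpZ.ne_zero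
  have hpos : (0 : ℤ) < p := by exact_mod_cast hp.pos
  have hy : Even y := by
    by_contra hy
    have h1 := Int.sq_emod_eight_of_odd (Int.not_even_iff_odd.1 hy)
    have h2 : x ^ 2 = 8 * (k * y ^ 2) + y ^ 2 + 1 := by rw [hk] at h; linarith
    rcases Int.even_or_odd x with hx | hx
    · obtain ⟨c, rfl⟩ := hx
      have : (c + c) ^ 2 = 4 * c ^ 2 := by ring
      omega
    · have := Int.sq_emod_eight_of_odd hx
      omega
  have hxo : Odd x := by
    by_contra hx
    rw [Int.not_odd_iff_even] at hx
    obtain ⟨c, rfl⟩ := hx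
    obtain ⟨d, rfl⟩ := hy
    have : 4 * (c ^ 2 - p * d ^ 2) = 1 := by rw [← h]; ring
    omega
  obtain ⟨c, rfl⟩ := hxo
  obtain ⟨w, rfl⟩ := hy
  have hc : c * (c + 1) = p * w ^ 2 := by linarith
  have hc0 : 0 < c := by omega
  have nonneg_sq : ∀ a b s : ℤ, 0 < a → IsCoprime a b → a * b = s ^ 2 → ∃ t, a = t ^ 2 := by
    intro a b s ha hab hs
    obtain ⟨t, ht | ht⟩ := Int.sq_of_isCoprime hab hs
    · exact ⟨t, ht⟩
    · nlinarith [sq_nonneg t]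
  have fix_sign : ∀ u v : ℤ, (u * v) ^ 2 = w ^ 2 → ∃ v', v' ^ 2 = v ^ 2 ∧ u * v' = w := by
    intro u v huv
    rcases sq_eq_sq_iff_eq_or_eq_neg.1 huv with h | h
    · exact ⟨v, rfl, h⟩
    · exact ⟨-v, by ring, by linarith⟩
  rcases hpZ.dvd_or_dvd ⟨_, hc⟩ with ⟨d, hd⟩ | ⟨d, hd⟩
  · have e : d * (c + 1) = w ^ 2 := mul_left_cancel₀ hp0 (by rw [← hc, hd]; ring)
    have cop : IsCoprime d (c + 1) := ⟨-p, 1, by rw [hd]; ring⟩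
    have hd0 : 0 < d := by
      rw [hd] at hc0
      exact pos_of_mul_pos_right hc0 hpos.le
    obtain ⟨v, hv⟩ := nonneg_sq _ _ _ hd0 cop e
    obtain ⟨u, hu⟩ := nonneg_sq _ _ w (by omega) cop.symm (by rw [mul_comm]; exact e)
    obtain ⟨v', hv', hw⟩ := fix_sign u v (by rw [mul_pow, ← hu, ← hv, ← e]; ring)
    exact ⟨u, v', 1, Or.inl rfl, by rw [hv', ← hv, ← hu, ← hd]; ring,
      by rw [hv', ← hv, ← hu, ← hd]; ring, by rw [← hw]; ring⟩
  · have e : c * d = w ^ 2 := mul_left_cancel₀ hp0 (by rw [← hc, hd]; ring)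
    have cop : IsCoprime c d := ⟨-1, p, by rw [← hd]; ring⟩
    have hd0 : 0 < d := by
      have : 0 < (p : ℤ) * d := by omega
      exact pos_of_mul_pos_right this hpos.le
    obtain ⟨u, hu⟩ := nonneg_sq _ _ _ hc0 cop e
    obtain ⟨v, hv⟩ := nonneg_sq _ _ w hd0 cop.symm (by rw [mul_comm]; exact e)
    obtain ⟨v', hv', hw⟩ := fix_sign u v (by rw [mul_pow, ← hu, ← hv, ← e])
    exact ⟨u, v', -1, Or.inr rfl, by rw [hv', ← hv, ← hu, ← hd]; ring,
      by rw [hv', ← hv, ← hu, ← hd]; ring, by rw [← hw]; ring⟩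

lemma fundamental_unit_norm_neg_one {p : ℕ} (hp : p.Prime) (hp8 : p % 8 = 1)
    (ε : (𝓞 (Qsqrt p))ˣ)
    (hε1 : 1 < (((ε : 𝓞 (Qsqrt p)) : Qsqrt p) : ℝ))
    (hεfund : ∀ u : (𝓞 (Qsqrt p))ˣ, 1 < (((u : 𝓞 (Qsqrt p)) : Qsqrt p) : ℝ) →
      (((ε : 𝓞 (Qsqrt p)) : Qsqrt p) : ℝ) ≤ (((u : 𝓞 (Qsqrt p)) : Qsqrt p) : ℝ)) :
    ∃ x y : ℤ, (((ε : 𝓞 (Qsqrt p)) : Qsqrt p) : ℝ) = x + y * √(p : ℝ) ∧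
      x ^ 2 - p * y ^ 2 = -1 := by
  have hsq : √(p : ℝ) ^ 2 = p := Real.sq_sqrt (Nat.cast_nonneg p)
  obtain ⟨x, y, he, h | h⟩ := exists_pell_of_unit hp hp8 ε
  swap
  · exact ⟨x, y, he, h⟩
  exfalso
  rw [he] at hε1 hεfund
  set s := √(p : ℝ)
  have hR : (x + y * s) * (x - y * s) = (1 : ℝ) := by
    have : (x : ℝ) ^ 2 - p * y ^ 2 = 1 := by exact_mod_cast h
    linear_combination this - (y : ℝ) ^ 2 * hsq
  have hx : 1 < x := by
    have : (1 : ℝ) < x := by nlinarith [sq_nonneg ((x : ℝ) + y * s - 1)]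
    exact_mod_cast this
  obtain ⟨u, v, m, hm, hN, rfl, rfl⟩ := exists_sqrt_of_pell hp hp8 hx h
  have hm' : -m = 1 ∨ -m = -1 := by omega
  have hsquare : (((u ^ 2 + p * v ^ 2 : ℤ) : ℝ) + ((2 * u * v : ℤ) : ℝ) * s) = (u + v * s) ^ 2 := by
    push_cast
    linear_combination -(v : ℝ) ^ 2 * hsq
  rw [hsquare] at hε1 hεfund
  obtain ⟨η, hη⟩ := exists_unit_of_pell hm hN
  obtain ⟨η', hη'⟩ := exists_unit_of_pell (p := p) (x := -u) (y := -v) hm (by linarith)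
  have h1 := hεfund η
  have h2 := hεfund η'
  rw [hη] at h1
  rw [hη'] at h2
  push_cast at h1 h2
  rcases lt_abs.1 ((one_lt_sq_iff_one_lt_abs _).1 hε1) with h3 | h3
  · nlinarith [h1 h3]
  · nlinarith [h2 (by linarith)]

/-- The Gaussian factorisation of `x² + 1 = p y²`. -/
lemma exists_gaussian_sqrt {p : ℕ} (hp : p.Prime) {a b x y : ℤ} (hab : (p : ℤ) = a ^ 2 + 4 * b ^ 2)
    (hx : Even x) (h : x ^ 2 + 1 = p * y ^ 2) (hdvd : (p : ℤ) ∣ a - 2 * b * x) :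
    ∃ z : GaussianInt, (⟨x, 1⟩ : GaussianInt) = ⟨0, 1⟩ * ⟨a, 2 * b⟩ * z ^ 2 := by
  have hp0 : (p : ℤ) ≠ 0 := by exact_mod_cast hp.ne_zero
  obtain ⟨e, he⟩ := hdvd
  obtain ⟨f, hf⟩ : (p : ℤ) ∣ a * x + 2 * b := by
    have : a * x + 2 * b = x * (a - 2 * b * x) + 2 * b * (x ^ 2 + 1) := by ring
    rw [this, he, h]
    exact ⟨x * e + 2 * b * y ^ 2, by ring⟩
  have hx1 : x = a * f - 2 * b * e := mul_left_cancel₀ hp0 (by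
    linear_combination a * hf - 2 * b * he + x * hab)
  have hx2 : 1 = a * e + 2 * b * f := mul_left_cancel₀ hp0 (by
    linear_combination a * he + 2 * b * hf + hab)
  have hfac : (⟨x, 1⟩ : GaussianInt) = ⟨a, 2 * b⟩ * ⟨f, e⟩ := by
    ext <;> simp <;> linarith
  have hfac' : (⟨x, -1⟩ : GaussianInt) = ⟨a, -(2 * b)⟩ * ⟨f, -e⟩ := by
    ext <;> simp <;> linarith
  have hcop : IsCoprime (⟨x, 1⟩ : GaussianInt) ⟨x, -1⟩ := by
    obtain ⟨k, rfl⟩ := hx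
    refine ⟨⟨k + k, -1⟩ + ⟨0, 2 * k ^ 2⟩, -⟨0, 2 * k ^ 2⟩, ?_⟩
    ext <;> simp <;> ring
  rw [hfac, hfac'] at hcop
  have hnorm : (⟨f, e⟩ : GaussianInt) * ⟨f, -e⟩ = (y : GaussianInt) ^ 2 := by
    have h1 : f ^ 2 + e ^ 2 = y ^ 2 := mul_left_cancel₀ hp0 (by
      rw [← h, hx1]
      have : (1 : ℤ) = (a * e + 2 * b * f) ^ 2 := by rw [← hx2]; ring
      rw [this, hab]
      ring)
    have : (y : GaussianInt) ^ 2 = ((y ^ 2 : ℤ) : GaussianInt) := by push_cast; rfl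
    rw [this, ← h1]
    ext <;> simp only [Zsqrtd.re_mul, Zsqrtd.im_mul, Zsqrtd.re_intCast, Zsqrtd.im_intCast] <;> ring
  obtain ⟨d, ⟨ζ, hζ⟩⟩ := exists_associated_pow_of_mul_eq_pow'
    (hcop.of_mul_left_right.of_mul_right_right) hnorm
  rw [hfac, ← hζ]
  have hn : (ζ : GaussianInt).re * (ζ : GaussianInt).re +
      (ζ : GaussianInt).im * (ζ : GaussianInt).im = 1 := by
    have := (Zsqrtd.norm_eq_one_iff' (by norm_num) (ζ : GaussianInt)).2 ζ.isUnit
    rw [Zsqrtd.norm_def] at this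
    linarith
  generalize (ζ : GaussianInt) = w at hn hζ
  obtain ⟨wr, wi⟩ := w
  obtain ⟨dr, di⟩ := d
  simp only at hn
  have hwi : wi ≠ 0 := by
    rintro rfl
    rw [← hζ] at hfac
    have := congrArg Zsqrtd.im hfac
    simp [pow_two] at this
    have : (1 : ℤ) = 2 * (b * (dr * dr - di * di) * wr + a * dr * di * wr) := by linarith
    omega
  have hwr : wr = 0 := by
    have : 0 < wi * wi := mul_self_pos.2 hwi
    nlinarith [mul_self_nonneg wr]
  subst hwr
  rcases mul_self_eq_one_iff.1 (show wi * wi = 1 by linarith) with rfl | rfl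
  · exact ⟨⟨dr, di⟩, by ring⟩
  · refine ⟨⟨0, 1⟩ * ⟨dr, di⟩, ?_⟩
    have : (⟨0, -1⟩ : GaussianInt) = ⟨0, 1⟩ * ⟨0, 1⟩ ^ 2 := by
      ext <;> simp [pow_two]
    rw [this]
    ring

lemma I_mem_QiSqrt (p : ℕ) : Complex.I ∈ QiSqrt p := mem_adjoin_pair_left ℚ _ _

lemma sqrt_mem_QiSqrt (p : ℕ) : ((√(p : ℝ) : ℝ) : ℂ) ∈ QiSqrt p := mem_adjoin_pair_right ℚ _ _

lemma exists_sqrt_mem_QiSqrt_of_dvd {p : ℕ} (hp : p.Prime) {a b x y : ℤ}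
    (hab : (p : ℤ) = a ^ 2 + 4 * b ^ 2) (hx : Even x) (h : x ^ 2 + 1 = p * y ^ 2)
    (hdvd : (p : ℤ) ∣ a - 2 * b * x) :
    ∃ μ ∈ QiSqrt p, μ ^ 2 =
      ((a : ℂ) + 2 * (b : ℂ) * Complex.I) * (x + y * ((√(p : ℝ) : ℝ) : ℂ)) := by
  have hsq : ((√(p : ℝ) : ℝ) : ℂ) ^ 2 = p := by
    rw [← Complex.ofReal_pow, Real.sq_sqrt (Nat.cast_nonneg p), Complex.ofReal_natCast]
  obtain ⟨⟨c, d⟩, hz⟩ := exists_gaussian_sqrt hp hab hx h hdvd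
  have hre := congrArg Zsqrtd.re hz
  have him := congrArg Zsqrtd.im hz
  simp [pow_two] at hre him
  have hI0 : (1 : ℂ) + Complex.I ≠ 0 := fun h => by simpa using congrArg Complex.re h
  obtain ⟨s, hs, hy⟩ : ∃ s : ℤ, s ^ 2 = 1 ∧ s * (c ^ 2 + d ^ 2) = y := by
    have hp0 : (p : ℤ) ≠ 0 := by exact_mod_cast hp.ne_zero
    have : y ^ 2 = (c ^ 2 + d ^ 2) ^ 2 := mul_left_cancel₀ hp0 (by
      linear_combination -h
        + (x - (2 * b * (c * c - d * d) + a * (c * d + d * c))) * hre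
        + (1 - 2 * b * (c * d + d * c) + a * (c * c - d * d)) * him
        - (c ^ 2 + d ^ 2) ^ 2 * hab)
    rcases sq_eq_sq_iff_eq_or_eq_neg.1 this with h | h
    · exact ⟨1, by norm_num, by rw [h]; ring⟩
    · exact ⟨-1, by norm_num, by rw [h]; ring⟩
  have hπ : (a : ℂ) + 2 * b * Complex.I ∈ QiSqrt p :=
    add_mem (intCast_mem _ a) (mul_mem (mul_mem (ofNat_mem _ 2) (intCast_mem _ b))
      (I_mem_QiSqrt p))
  have hζ : (c : ℂ) + d * Complex.I ∈ QiSqrt p :=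
    add_mem (intCast_mem _ c) (mul_mem (intCast_mem _ d) (I_mem_QiSqrt p))
  have hζ' : (c : ℂ) - d * Complex.I ∈ QiSqrt p :=
    sub_mem (intCast_mem _ c) (mul_mem (intCast_mem _ d) (I_mem_QiSqrt p))
  refine ⟨(Complex.I * (a + 2 * b * Complex.I) * (c + d * Complex.I) +
      (c - d * Complex.I) * ((√(p : ℝ) : ℝ) : ℂ) * s) / (1 + Complex.I),
    div_mem (add_mem (mul_mem (mul_mem (I_mem_QiSqrt p) hπ) hζ)
      (mul_mem (mul_mem hζ' (sqrt_mem_QiSqrt p)) (intCast_mem _ s)))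
      (add_mem (one_mem _) (I_mem_QiSqrt p)), ?_⟩
  have hpC : (p : ℂ) = (a + 2 * b * Complex.I) * (a - 2 * b * Complex.I) := by
    have : (p : ℂ) = a ^ 2 + 4 * b ^ 2 := by exact_mod_cast hab
    linear_combination this + 4 * (b : ℂ) ^ 2 * Complex.I_sq
  have hnorm : ((c : ℂ) + d * Complex.I) * (c - d * Complex.I) = c ^ 2 + d ^ 2 := by
    linear_combination -(d : ℂ) ^ 2 * Complex.I_sq
  have hxC : ((a : ℂ) - 2 * b * Complex.I) * (c - d * Complex.I) ^ 2 -
      (a + 2 * b * Complex.I) * (c + d * Complex.I) ^ 2 = 2 * Complex.I * x := by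
    rw [hre]
    push_cast
    linear_combination -4 * b * d ^ 2 * Complex.I * Complex.I_sq
  have hsC : (s : ℂ) ^ 2 = 1 := by exact_mod_cast hs
  have hyC : (s : ℂ) * (c ^ 2 + d ^ 2) = y := by exact_mod_cast hy
  have hI : (1 + Complex.I) ^ 2 = 2 * Complex.I := by linear_combination Complex.I_sq
  rw [div_pow, div_eq_iff (pow_ne_zero 2 hI0), hI]
  generalize (a : ℂ) + 2 * b * Complex.I = π at *
  generalize (a : ℂ) - 2 * b * Complex.I = π' at *
  generalize (c : ℂ) + d * Complex.I = ζ at *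
  generalize (c : ℂ) - d * Complex.I = ζ' at *
  generalize ((√(p : ℝ) : ℝ) : ℂ) = t at *
  linear_combination π ^ 2 * ζ ^ 2 * Complex.I_sq + 2 * Complex.I * π * t * s * hnorm +
    2 * Complex.I * π * t * hyC + ζ' ^ 2 * s ^ 2 * hsq + ζ' ^ 2 * p * hsC + ζ' ^ 2 * hpC + π * hxC

lemma exists_sqrt_mem_QiSqrt {p : ℕ} (hp : p.Prime) {a b x y : ℤ}
    (hab : (p : ℤ) = a ^ 2 + 4 * b ^ 2) (hx : Even x) (h : x ^ 2 + 1 = p * y ^ 2) :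
    ∃ μ ∈ QiSqrt p, μ ^ 2 =
      ((a : ℂ) + 2 * (b : ℂ) * Complex.I) * (x + y * ((√(p : ℝ) : ℝ) : ℂ)) := by
  have hsq : ((√(p : ℝ) : ℝ) : ℂ) ^ 2 = p := by
    rw [← Complex.ofReal_pow, Real.sq_sqrt (Nat.cast_nonneg p), Complex.ofReal_natCast]
  have hpZ : Prime (p : ℤ) := Nat.prime_iff_prime_int.1 hp
  have hdvd : (p : ℤ) ∣ (a - 2 * b * x) * (a - 2 * (-b) * x) :=
    ⟨1 - 4 * b ^ 2 * y ^ 2, by linear_combination -4 * b ^ 2 * h - hab⟩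
  rcases hpZ.dvd_or_dvd hdvd with hd | hd
  · exact exists_sqrt_mem_QiSqrt_of_dvd hp hab hx h hd
  obtain ⟨μ, hμ, hμ2⟩ := exists_sqrt_mem_QiSqrt_of_dvd hp (b := -b) (by rw [hab]; ring) hx h hd
  have hp0 : (p : ℂ) ≠ 0 := by exact_mod_cast hp.ne_zero
  have hs0 : ((√(p : ℝ) : ℝ) : ℂ) ≠ 0 := fun h => hp0 (by rw [← hsq, h]; ring)
  have hπ : (a : ℂ) + 2 * (b : ℂ) * Complex.I ∈ QiSqrt p :=
    add_mem (intCast_mem _ a) (mul_mem (mul_mem (ofNat_mem _ 2) (intCast_mem _ b))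
      (I_mem_QiSqrt p))
  refine ⟨μ * (a + 2 * b * Complex.I) / ((√(p : ℝ) : ℝ) : ℂ),
    div_mem (mul_mem hμ hπ) (sqrt_mem_QiSqrt p), ?_⟩
  have habC : (p : ℂ) = a ^ 2 + 4 * b ^ 2 := by exact_mod_cast hab
  rw [div_pow, mul_pow, hμ2, hsq, div_eq_iff hp0, habC]
  push_cast
  linear_combination (-4 * (b : ℂ) ^ 2 * (x + y * ((√(p : ℝ) : ℝ) : ℂ)) *
    (a + 2 * b * Complex.I)) * Complex.I_sq

/-- For a prime `p ≡ 1 mod 8` with `p = a² + 4b²` and fundamental unit `ε` of `ℚ(√p)`,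
the number `(a + 2bi)·ε` is a square in `ℚ(i, √p)`. -/
theorem unit_times_gaussian_factor_is_square
    (p : ℕ) (hp : p.Prime) (hp8 : p % 8 = 1)
    (a b : ℤ) (hab : (p : ℤ) = a ^ 2 + 4 * b ^ 2)
    [NumberField (Qsqrt p)]
    (ε : (𝓞 (Qsqrt p))ˣ)
    (hε1 : 1 < (((ε : 𝓞 (Qsqrt p)) : Qsqrt p) : ℝ))
    (hεfund : ∀ u : (𝓞 (Qsqrt p))ˣ, 1 < (((u : 𝓞 (Qsqrt p)) : Qsqrt p) : ℝ) →
      (((ε : 𝓞 (Qsqrt p)) : Qsqrt p) : ℝ) ≤ (((u : 𝓞 (Qsqrt p)) : Qsqrt p) : ℝ)) :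
    ∃ μ ∈ QiSqrt p, μ ^ 2 =
      ((a : ℂ) + 2 * (b : ℂ) * Complex.I) * (((((ε : 𝓞 (Qsqrt p)) : Qsqrt p) : ℝ) : ℂ)) := by
  obtain ⟨x, y, he, h⟩ := fundamental_unit_norm_neg_one hp hp8 ε hε1 hεfund
  have hx : Even x := by
    by_contra hx
    rw [Int.not_even_iff_odd] at hx
    obtain ⟨k, hk⟩ : ∃ k : ℤ, (p : ℤ) = 8 * k + 1 := ⟨p / 8, by omega⟩
    have h1 := Int.sq_emod_eight_of_odd hx
    have h2 : x ^ 2 = 8 * (k * y ^ 2) + y ^ 2 - 1 := by rw [hk] at h; linarith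
    rcases Int.even_or_odd y with hy | hy
    · obtain ⟨c, rfl⟩ := hy
      have : (c + c) ^ 2 = 4 * c ^ 2 := by ring
      omega
    · have := Int.sq_emod_eight_of_odd hy
      omega
  obtain ⟨μ, hμ, hμ2⟩ := exists_sqrt_mem_QiSqrt hp hab hx (y := y) (by linarith)
  refine ⟨μ, hμ, ?_⟩
  rw [hμ2, he]
  push_cast
  rfl
end

section
/- Let a be an odd positive integer, let s ∈ {+1, −1}, and suppose that m := 3a² + 4s is squarefree. Then the real number ε := (1/3)·((3a + √(3m))/2)² = (3a² + 2s)/2 + (a/2)·√(3m) is an algebraic integer lying in the ring of integers of the real quadratic field ℚ(√(3m)) ⊂ ℝ, and ε is a unit of that ring (its norm to ℚ equals 1). -/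
open NumberField IntermediateField

/-- The real quadratic field `ℚ(√d) ⊂ ℝ` for an integer `d`. -/
noncomputable def QsqrtZ (d : ℤ) : IntermediateField ℚ ℝ := ℚ⟮(Real.sqrt (d : ℝ) : ℝ)⟯

open Polynomial in
theorem isIntegral_of_quadratic {R A : Type*} [CommRing R] [Ring A] [Algebra R A] {x : A}
    {b c : R} (h : x ^ 2 + algebraMap R A b * x + algebraMap R A c = 0) : IsIntegral R x :=
  ⟨X ^ 2 + C b * X + C c, by monicity!, by simpa using h⟩

open Polynomial in
theorem minpoly_eq_quadratic {F L : Type*} [Field F] [Field L] [Algebra F L] {x : L} {b c : F}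
    (hx : x ∉ (algebraMap F L).range)
    (h : x ^ 2 + algebraMap F L b * x + algebraMap F L c = 0) :
    minpoly F x = X ^ 2 + C b * X + C c := by
  have hmonic : (X ^ 2 + C b * X + C c : F[X]).Monic := by monicity!
  have hint : IsIntegral F x := isIntegral_of_quadratic h
  refine (eq_of_monic_of_dvd_of_natDegree_le (minpoly.monic hint) hmonic
    (minpoly.dvd F x (by simpa using h)) ?_).symm
  have hdeg : (X ^ 2 + C b * X + C c : F[X]).natDegree = 2 := by compute_degree!
  rw [hdeg]
  exact (minpoly.two_le_natDegree_iff hint).2 hx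

open Polynomial in
theorem norm_eq_of_quadratic {F L : Type*} [Field F] [Field L] [Algebra F L]
    (hL : Module.finrank F L = 2) {x : L} {b c : F} (hx : x ∉ (algebraMap F L).range)
    (h : x ^ 2 + algebraMap F L b * x + algebraMap F L c = 0) :
    Algebra.norm F x = c := by
  have : FiniteDimensional F L := Module.finite_of_finrank_pos (by omega)
  have hdvd : minpoly F x ∣ (Algebra.lmul F L x).charpoly :=
    minpoly.dvd F x (Algebra.aeval_self_charpoly_lmul x)
  have hdeg : (X ^ 2 + C b * X + C c : F[X]).natDegree = 2 := by compute_degree!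
  rw [minpoly_eq_quadratic hx h] at hdvd
  have hchar := eq_of_monic_of_dvd_of_natDegree_le (by monicity!)
    (LinearMap.charpoly_monic _) hdvd (by rw [LinearMap.charpoly_natDegree, hL, hdeg])
  rw [Algebra.norm_apply, LinearMap.det_eq_sign_charpoly_coeff, hL]
  change (-1) ^ 2 * (Algebra.lmul F L x).charpoly.coeff 0 = c
  rw [hchar]
  simp

/-- Three times an integer prime to `3` is not a square. -/
theorem not_isSquare_three_mul {m : ℤ} (h3 : ¬ 3 ∣ m) : ¬ IsSquare (3 * m) := by
  rintro ⟨r, hr⟩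
  have hp : Prime (3 : ℤ) := Int.prime_three
  obtain ⟨k, rfl⟩ : (3 : ℤ) ∣ r := by
    rcases hp.dvd_or_dvd (Dvd.intro _ hr) with h | h <;> exact h
  exact h3 ⟨k * k, by linarith⟩

theorem irrational_notMem_range {K : IntermediateField ℚ ℝ} {x : K} (hx : Irrational (x : ℝ)) :
    x ∉ (algebraMap ℚ K).range := by
  rintro ⟨q, rfl⟩
  exact hx ⟨q, rfl⟩

theorem finrank_QsqrtZ {d : ℤ} (hd : 0 ≤ d) (hirr : Irrational (Real.sqrt (d : ℝ))) :
    Module.finrank ℚ (QsqrtZ d) = 2 := by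
  have hx : Real.sqrt (d : ℝ) ∉ (algebraMap ℚ ℝ).range := by
    rintro ⟨q, hq⟩
    exact hirr ⟨q, hq⟩
  have hroot : Real.sqrt (d : ℝ) ^ 2 + algebraMap ℚ ℝ 0 * Real.sqrt (d : ℝ) +
      algebraMap ℚ ℝ (-d) = 0 := by
    simp [Real.sq_sqrt (Int.cast_nonneg hd : (0 : ℝ) ≤ d)]
  rw [QsqrtZ, IntermediateField.adjoin.finrank (isIntegral_of_quadratic hroot),
    minpoly_eq_quadratic hx hroot]
  compute_degree!

/-- For odd positive `a` and `s = ±1` with `m = 3a² + 4s` squarefree (and positive, so that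
`ℚ(√(3m))` is a real quadratic field), the real number
`ε = (3a² + 2s)/2 + (a/2)·√(3m)` is a unit of the ring of integers of `ℚ(√(3m))`,
of norm `1`. -/
theorem quadratic_unit_of_squarefree_3a2_plus_4s
    (a : ℤ) (ha_odd : Odd a) (ha_pos : 0 < a)
    (s : ℤ) (hs : s = 1 ∨ s = -1)
    (m : ℤ) (hm : m = 3 * a ^ 2 + 4 * s) (hm_sqfree : Squarefree m) (hm_pos : 0 < m)
    [NumberField (QsqrtZ (3 * m))] :
    ∃ u : 𝓞 (QsqrtZ (3 * m)),
      ((u : QsqrtZ (3 * m)) : ℝ) =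
        (3 * (a : ℝ) ^ 2 + 2 * (s : ℝ)) / 2 + ((a : ℝ) / 2) * Real.sqrt ((3 * m : ℤ) : ℝ) ∧
      IsUnit u ∧
      Algebra.norm ℚ ((u : QsqrtZ (3 * m)) : QsqrtZ (3 * m)) = 1 := by
  have hmR : (m : ℝ) = 3 * (a : ℝ) ^ 2 + 4 * s := by rw [hm]; push_cast; ring
  have hsR : (s : ℝ) ^ 2 = 1 := by rcases hs with rfl | rfl <;> norm_num
  have hd : 0 ≤ 3 * m := by omega
  have h3 : ¬ 3 ∣ m := by
    rcases hs with rfl | rfl <;> omega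
  have hirr : Irrational (Real.sqrt ((3 * m : ℤ) : ℝ)) :=
    (irrational_sqrt_intCast_iff_of_nonneg hd).2 (not_isSquare_three_mul h3)
  have hsq : Real.sqrt ((3 * m : ℤ) : ℝ) ^ 2 = 3 * (3 * (a : ℝ) ^ 2 + 4 * s) := by
    rw [Real.sq_sqrt (Int.cast_nonneg hd), Int.cast_mul, hmR, Int.cast_ofNat]
  let r : QsqrtZ (3 * m) := ⟨_, mem_adjoin_simple_self ℚ (Real.sqrt ((3 * m : ℤ) : ℝ))⟩
  have hr : (r : ℝ) = Real.sqrt ((3 * m : ℤ) : ℝ) := rfl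
  let x : QsqrtZ (3 * m) := (3 * a ^ 2 + 2 * s) / 2 + a / 2 * r
  have hx : (x : ℝ) =
      (3 * (a : ℝ) ^ 2 + 2 * (s : ℝ)) / 2 + ((a : ℝ) / 2) * Real.sqrt ((3 * m : ℤ) : ℝ) := by
    simp only [x, ← hr]
    push_cast
    rfl
  have hroot : x ^ 2 - (3 * a ^ 2 + 2 * s : ℤ) * x + 1 = 0 := by
    apply Subtype.ext
    push_cast
    change (x : ℝ) ^ 2 - (3 * (a : ℝ) ^ 2 + 2 * s) * x + 1 = 0
    rw [hx]
    linear_combination (a : ℝ) ^ 2 / 4 * hsq - hsR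
  have hint : IsIntegral ℤ x := by
    refine isIntegral_of_quadratic (b := -(3 * a ^ 2 + 2 * s)) (c := 1) ?_
    rw [← hroot, map_neg, map_one, eq_intCast]
    ring
  have hxirr : Irrational (x : ℝ) := by
    have ha : (a : ℚ) / 2 ≠ 0 := div_ne_zero (Int.cast_ne_zero.2 ha_pos.ne') two_ne_zero
    have := (hirr.ratCast_mul ha).ratCast_add ((3 * (a : ℚ) ^ 2 + 2 * s) / 2)
    rw [hx]
    exact_mod_cast this
  let u : 𝓞 (QsqrtZ (3 * m)) := ⟨x, hint⟩
  refine ⟨u, hx, IsUnit.of_mul_eq_one ((3 * a ^ 2 + 2 * s : ℤ) - u) ?_, ?_⟩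
  · apply RingOfIntegers.ext
    change x * ((3 * a ^ 2 + 2 * s : ℤ) - x) = 1
    linear_combination -hroot
  · refine norm_eq_of_quadratic (b := -(3 * (a : ℚ) ^ 2 + 2 * s)) (finrank_QsqrtZ hd hirr)
      (irrational_notMem_range hxirr) ?_
    change x ^ 2 + _ * x + _ = 0
    rw [← hroot]
    push_cast
    simp
    ring
end

section
/- Let ε = (25 + 3√69)/2, the fundamental unit of ℚ(√69), regarded as an element of the number field K = ℚ(√−3, √69) ⊂ ℂ. Let p be a prime with p ≡ 1 (mod 3), p ≠ 23, such that −23 is a quadratic residue modulo p, and let P be any prime ideal of 𝓞_K lying above p. Then ε is a cube in the residue field 𝓞_K/P if and only if there exist integers x, y with p = x² + xy + 6y². -/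
open NumberField IntermediateField

/-- The biquadratic field `K = ℚ(√-3, √69) ⊂ ℂ`. -/
noncomputable def Ksqrt69 : IntermediateField ℚ ℂ :=
  ℚ⟮(Complex.I * Real.sqrt 3 : ℂ), ((Real.sqrt 69 : ℝ) : ℂ)⟯

/-- The ring of Eisenstein integers `ℤ[ω]`, with `ω² = -1 - ω`. -/
abbrev EisensteinInt := QuadraticAlgebra ℤ (-1) (-1)

namespace EisensteinInt

open QuadraticAlgebra

theorem norm_eq (z : EisensteinInt) : norm z = z.re ^ 2 - z.re * z.im + z.im ^ 2 := by
  rw [norm_def]; ring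

theorem norm_eq_zero {z : EisensteinInt} (h : norm z = 0) : z = 0 := by
  rw [norm_eq] at h
  have him : z.im = 0 := by nlinarith [sq_nonneg (2 * z.re - z.im), sq_nonneg z.im]
  have hre : z.re = 0 := by rw [him] at h; nlinarith
  ext <;> simp [hre, him]

instance : IsDomain EisensteinInt :=
  have : NoZeroDivisors EisensteinInt := ⟨fun {a b} h => by
    have := congrArg QuadraticAlgebra.norm h
    rw [map_mul, QuadraticAlgebra.norm_zero, mul_eq_zero] at this
    exact this.imp norm_eq_zero norm_eq_zero⟩
  NoZeroDivisors.to_isDomain _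

theorem mul_star_eq_norm (z : EisensteinInt) : z * star z = (norm z : ℤ) :=
  (algebraMap_norm_eq_mul_star z).symm

theorem star_eq_inv_of_pow_three {c : EisensteinInt} (h : c ^ 3 = 1) : c * star c = 1 := by
  have h1 : norm c ^ 3 = 1 := by rw [← map_pow, h, QuadraticAlgebra.norm_one]
  have h2 : norm c = 1 := by
    have : (norm c - 1) * (norm c ^ 2 + norm c + 1) = 0 := by linear_combination h1
    rcases mul_eq_zero.mp this with h | h
    · linarith
    · nlinarith [sq_nonneg (norm c)]
  rw [mul_star_eq_norm, h2, Int.cast_one]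

theorem eq_one_of_map_eq_one {k : Type*} [Field k] (h3 : (3 : k) ≠ 0) (φ : EisensteinInt →+* k)
    {c : EisensteinInt} (hc : c ^ 3 = 1) (h : φ c = 1) : c = 1 := by
  have : (c - 1) * (c ^ 2 + c + 1) = 0 := by linear_combination hc
  rcases mul_eq_zero.mp this with h' | h'
  · exact sub_eq_zero.mp h'
  · have := congrArg φ h'
    simp only [map_add, map_pow, h, map_one, map_zero] at this
    exact absurd (by linear_combination this) h3

theorem isPrimitiveRoot_omega : IsPrimitiveRoot (⟨0, 1⟩ : EisensteinInt) 3 := by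
  refine IsPrimitiveRoot.mk_of_lt _ (by norm_num) (by ext <;> simp [pow_succ]) ?_
  intro l hl hl3 h
  interval_cases l
  · simpa using congrArg QuadraticAlgebra.im h
  · simpa [pow_succ] using congrArg QuadraticAlgebra.im h

/-- The ring homomorphism out of `ℤ[ω]` determined by the image `u` of `ω`. -/
noncomputable def homOfRoot {k : Type*} [Field k] (u : k) (hu : u ^ 2 + u + 1 = 0) :
    EisensteinInt →+* k :=
  (QuadraticAlgebra.lift (R := ℤ) ⟨u, by
    simp only [neg_smul, one_smul]; linear_combination hu⟩).toRingHom

theorem homOfRoot_apply {k : Type*} [Field k] (u : k) (hu : u ^ 2 + u + 1 = 0)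
    (z : EisensteinInt) : homOfRoot u hu z = z.re + z.im * u := by
  simp [homOfRoot, QuadraticAlgebra.lift]

/-- For a prime `ℓ ≠ 3` and `φ : ℤ[ω] → k` with `k` of characteristic `ℓ`, the image in `k` of the
cubic residue symbol `(z / ℓ)₃`. -/
noncomputable def cubicSymbol {k : Type*} [Field k] (φ : EisensteinInt →+* k) (l : ℕ)
    (z : EisensteinInt) : k :=
  if l % 3 = 1 then (φ z / φ (star z)) ^ ((l - 1) / 3) else (φ (star z) / φ z) ^ ((l + 1) / 3)

section

variable {k : Type*} [Field k] (φ : EisensteinInt →+* k) (l : ℕ)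

theorem cubicSymbol_mul (z w : EisensteinInt) :
    cubicSymbol φ l (z * w) = cubicSymbol φ l z * cubicSymbol φ l w := by
  unfold cubicSymbol
  split_ifs <;> rw [star_mul', map_mul, map_mul, mul_div_mul_comm, mul_pow]

theorem cubicSymbol_eq_one {z : EisensteinInt} (h : φ (star z) = φ z) (h0 : φ z ≠ 0) :
    cubicSymbol φ l z = 1 := by
  unfold cubicSymbol
  split_ifs <;> rw [h, div_self h0, one_pow]

theorem map_cubicSymbol {E : Type*} [Field E] (f : k →+* E) (z : EisensteinInt) :
    f (cubicSymbol φ l z) = cubicSymbol (f.comp φ) l z := by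
  unfold cubicSymbol
  split_ifs <;> simp

end

theorem mulChar_pow_three_apply {F R : Type*} [Field F] [CommRing R] {χ : MulChar F R}
    (hχ : χ ^ 3 = 1) {a : F} (ha : a ≠ 0) : χ a ^ 3 = 1 := by
  rw [← MulChar.pow_apply' χ (by norm_num), hχ, MulChar.one_apply (isUnit_iff_ne_zero.mpr ha)]

section GaussSum

variable {q l : ℕ} [Fact q.Prime] [Fact l.Prime] {E : Type*} [Field E] [CharP E l]

theorem gaussSum_mul_gaussSum_inv_of_pow_three {χ : MulChar (ZMod q) E} (hχ : χ ^ 3 = 1)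
    (hχ1 : χ ≠ 1) {ψ : AddChar (ZMod q) E} (hψ : ψ.IsPrimitive) :
    gaussSum χ ψ * gaussSum χ⁻¹ ψ = q := by
  have h := gaussSum_mul_gaussSum_eq_card hχ1 hψ
  rw [ZMod.card] at h
  have h2 := mul_gaussSum_inv_eq_gaussSum χ⁻¹ ψ
  have h3 : χ⁻¹ (-1) = 1 := by
    have a3 := mulChar_pow_three_apply (χ := χ⁻¹) (by rw [inv_pow, hχ, inv_one])
      (a := -1) (by simp)
    have a2 : χ⁻¹ (-1) ^ 2 = 1 := by rw [← map_pow]; simp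
    rw [pow_succ, a2, one_mul] at a3
    exact a3
  rw [← h2, h3, one_mul, h]

theorem gaussSum_pow_char_of_mod_one (hlq : l ≠ q) (hl : l % 3 = 1) {χ : MulChar (ZMod q) E}
    (hχ : χ ^ 3 = 1) (ψ : AddChar (ZMod q) E) :
    gaussSum χ ψ ^ l = χ⁻¹ l * gaussSum χ ψ := by
  have hu : IsUnit (l : ZMod q) := by
    rw [ZMod.isUnit_iff_coprime]
    exact (Nat.coprime_primes Fact.out Fact.out).mpr hlq
  have : χ ^ l = χ := by
    conv_lhs => rw [← Nat.div_add_mod l 3, hl, pow_add, pow_mul, hχ, one_pow, one_mul, pow_one]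
  rw [gaussSum_frob, this, AddChar.pow_mulShift, ← hu.unit_spec, gaussSum_mulShift_eq]

theorem gaussSum_pow_char_of_mod_two (hlq : l ≠ q) (hl : l % 3 = 2) {χ : MulChar (ZMod q) E}
    (hχ : χ ^ 3 = 1) (ψ : AddChar (ZMod q) E) :
    gaussSum χ ψ ^ l = χ l * gaussSum χ⁻¹ ψ := by
  have hu : IsUnit (l : ZMod q) := by
    rw [ZMod.isUnit_iff_coprime]
    exact (Nat.coprime_primes Fact.out Fact.out).mpr hlq
  have : χ ^ l = χ⁻¹ := by
    conv_lhs => rw [← Nat.div_add_mod l 3, hl, pow_add, pow_mul, hχ, one_pow, one_mul]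
    rw [eq_inv_iff_mul_eq_one, ← pow_succ, hχ]
  rw [gaussSum_frob, this, AddChar.pow_mulShift, ← hu.unit_spec, gaussSum_mulShift_eq, inv_inv]

theorem jacobiSum_div_pow (hlq : l ≠ q) (hl3 : l ≠ 3) {χ : MulChar (ZMod q) E}
    (hχ : χ ^ 3 = 1) (hχ1 : χ ≠ 1) {ψ : AddChar (ZMod q) E} (hψ : ψ.IsPrimitive) :
    (if l % 3 = 1 then (jacobiSum χ χ / jacobiSum χ⁻¹ χ⁻¹) ^ ((l - 1) / 3)
      else (jacobiSum χ⁻¹ χ⁻¹ / jacobiSum χ χ) ^ ((l + 1) / 3)) = χ l := by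
  have hχi : χ⁻¹ ^ 3 = 1 := by rw [inv_pow, hχ, inv_one]
  have hχi1 : χ⁻¹ ≠ 1 := inv_ne_one.mpr hχ1
  have hsq : χ * χ = χ⁻¹ := by rw [eq_inv_iff_mul_eq_one, ← pow_three', hχ]
  have hsqi : χ⁻¹ * χ⁻¹ = χ := by rw [← mul_inv, hsq, inv_inv]
  have hq0 : (q : E) ≠ 0 := by
    rw [Ne, CharP.cast_eq_zero_iff E l]
    exact fun h => hlq ((Nat.prime_dvd_prime_iff_eq Fact.out Fact.out).mp h)
  have hl0 : (l : ZMod q) ≠ 0 := by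
    rw [Ne, ZMod.natCast_eq_zero_iff]
    exact fun h => hlq ((Nat.prime_dvd_prime_iff_eq Fact.out Fact.out).mp h).symm
  have hGH := gaussSum_mul_gaussSum_inv_of_pow_three hχ hχ1 hψ
  have hj := jacobiSum_mul_nontrivial (χ := χ) (φ := χ) (by rwa [hsq]) ψ
  have hj' := jacobiSum_mul_nontrivial (χ := χ⁻¹) (φ := χ⁻¹) (by rwa [hsqi]) ψ
  rw [hsq] at hj
  rw [hsqi] at hj'
  have hc3 : χ (l : ZMod q) ^ 3 = 1 := mulChar_pow_three_apply hχ hl0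
  have hcc : χ (l : ZMod q) * χ⁻¹ (l : ZMod q) = 1 := by
    rw [← MulChar.mul_apply, mul_inv_cancel, MulChar.one_apply (isUnit_iff_ne_zero.mpr hl0)]
  have hF1 := fun h => gaussSum_pow_char_of_mod_one (E := E) hlq h hχ ψ
  have hF1' := fun h => gaussSum_pow_char_of_mod_one (E := E) hlq h hχi ψ
  have hF2 := fun h => gaussSum_pow_char_of_mod_two (E := E) hlq h hχ ψ
  have hF2' := fun h => gaussSum_pow_char_of_mod_two (E := E) hlq h hχi ψ
  rw [inv_inv] at hF1' hF2'
  generalize gaussSum χ ψ = G at *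
  generalize gaussSum χ⁻¹ ψ = H at *
  generalize jacobiSum χ χ = j at *
  generalize jacobiSum χ⁻¹ χ⁻¹ = j' at *
  generalize χ (l : ZMod q) = c at *
  generalize χ⁻¹ (l : ZMod q) = c' at *
  have hG : G ≠ 0 := by rintro rfl; exact hq0 (by rw [← hGH, zero_mul])
  have hH : H ≠ 0 := by rintro rfl; exact hq0 (by rw [← hGH, mul_zero])
  obtain rfl : j = G * G / H := by rw [eq_div_iff hH, mul_comm, hj]
  obtain rfl : j' = H * H / G := by rw [eq_div_iff hG, mul_comm, hj']
  have hc' : c' = c ^ 2 := by linear_combination c' * hc3.symm + c ^ 2 * hcc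
  subst hc'
  have hc0 : c ≠ 0 := by rintro rfl; simp at hc3
  split_ifs with h
  · obtain ⟨m, rfl⟩ : ∃ m, l = 3 * m + 1 := ⟨l / 3, by omega⟩
    have e : (3 * m + 1 - 1) / 3 = m := by omega
    have h1 := hF1 h
    have h2 := hF1' h
    rw [pow_succ, pow_mul] at h1 h2
    have h1 := mul_right_cancel₀ hG h1
    have h2 := mul_right_cancel₀ hH h2
    rw [e, show G * G / H / (H * H / G) = G ^ 3 / H ^ 3 by field_simp, div_pow, h1, h2]
    field_simp
  · have hl : l % 3 = 2 := by
      have : l % 3 ≠ 0 := fun h0 => hl3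
        ((Nat.prime_dvd_prime_iff_eq Nat.prime_three Fact.out).mp (Nat.dvd_of_mod_eq_zero h0)).symm
      omega
    obtain ⟨m, rfl⟩ : ∃ m, l = 3 * m + 2 := ⟨l / 3, by omega⟩
    have e : (3 * m + 2 + 1) / 3 = m + 1 := by omega
    have h1 := hF2 hl
    have h2 := hF2' hl
    rw [e, show H * H / G / (G * G / H) = H ^ 3 / G ^ 3 by field_simp, div_pow, ← pow_mul,
      ← pow_mul, show 3 * (m + 1) = 3 * m + 2 + 1 by ring, pow_succ, pow_succ G, h1, h2]
    field_simp

end GaussSum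

theorem three_ne_zero_of_charP (l : ℕ) [Fact l.Prime] (hl3 : l ≠ 3) {k : Type*} [Field k]
    [CharP k l] : (3 : k) ≠ 0 := by
  have := (CharP.cast_eq_zero_iff k l 3).not.mpr fun h => hl3
    ((Nat.prime_dvd_prime_iff_eq Fact.out Nat.prime_three).mp h)
  exact_mod_cast this

theorem star_mulChar_apply {F : Type*} [Field F] {χ : MulChar F EisensteinInt}
    (hχ : χ ^ 3 = 1) : χ.ringHomComp (starRingEnd EisensteinInt) = χ⁻¹ := by
  refine MulChar.ext fun u => ?_
  have h1 := star_eq_inv_of_pow_three (mulChar_pow_three_apply hχ u.ne_zero)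
  have h2 : χ u * χ⁻¹ u = 1 := by
    rw [← MulChar.mul_apply, mul_inv_cancel, MulChar.one_apply u.isUnit]
  have h0 : χ u ≠ 0 := fun h => by simp [h] at h1
  exact mul_left_cancel₀ h0 (h1.trans h2.symm)

theorem star_jacobiSum {F : Type*} [Field F] [Fintype F] {χ : MulChar F EisensteinInt}
    (hχ : χ ^ 3 = 1) : star (jacobiSum χ χ) = jacobiSum χ⁻¹ χ⁻¹ := by
  rw [← star_mulChar_apply hχ, jacobiSum_ringHomComp]
  rfl

theorem norm_jacobiSum {q : ℕ} [Fact q.Prime] {χ : MulChar (ZMod q) EisensteinInt}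
    (hχ : χ ^ 3 = 1) (hχ1 : χ ≠ 1) : QuadraticAlgebra.norm (jacobiSum χ χ) = q := by
  let f := algebraMap EisensteinInt (FractionRing EisensteinInt)
  have hf : Function.Injective f := IsFractionRing.injective _ _
  have : CharZero (FractionRing EisensteinInt) := charZero_of_injective_algebraMap hf
  have hne := (MulChar.ringHomComp_ne_one_iff hf).mpr hχ1
  have hsq : χ.ringHomComp f * χ.ringHomComp f ≠ 1 := by
    rw [← MulChar.ringHomComp_mul, MulChar.ringHomComp_ne_one_iff hf]
    intro h
    rw [pow_three', h, one_mul] at hχ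
    exact hχ1 hχ
  have h := jacobiSum_mul_jacobiSum_inv
    (by rw [ringChar.eq_zero, ZMod.ringChar_zmod_n]; exact (Fact.out : q.Prime).ne_zero.symm)
    hne hne hsq
  rw [MulChar.ringHomComp_inv, jacobiSum_ringHomComp, jacobiSum_ringHomComp, ← star_jacobiSum hχ,
    ← map_mul, mul_star_eq_norm, ZMod.card, map_intCast] at h
  exact_mod_cast h

theorem three_dvd_im_jacobiSum {q : ℕ} [Fact q.Prime] (hq : q % 3 = 1)
    {χ : MulChar (ZMod q) EisensteinInt} (hχ : χ ^ 3 = 1) : 3 ∣ (jacobiSum χ χ).im := by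
  obtain ⟨z, -, hz⟩ := exists_jacobiSum_eq_neg_one_add (by norm_num) hχ hχ
    (by rw [ZMod.card]; omega) isPrimitiveRoot_omega
  rw [hz]
  refine ⟨z.im - z.re, ?_⟩
  simp [pow_two]
  ring

theorem cubicSymbol_jacobiSum {q l : ℕ} [Fact q.Prime] [Fact l.Prime] (hlq : l ≠ q) (hl3 : l ≠ 3)
    {χ : MulChar (ZMod q) EisensteinInt} (hχ : χ ^ 3 = 1) (hχ1 : χ ≠ 1)
    {k : Type*} [Field k] [CharP k l] (φ : EisensteinInt →+* k) :
    cubicSymbol φ l (jacobiSum χ χ) = φ (χ l) := by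
  let ψ := AddChar.FiniteField.primitiveChar (ZMod q) k
    (by rwa [ringChar.eq k l, ZMod.ringChar_zmod_n])
  let E := CyclotomicField ψ.n k
  let f := algebraMap k E
  have : CharP E l := charP_of_injective_algebraMap f.injective l
  apply f.injective
  let χ' := χ.ringHomComp (f.comp φ)
  have hχ' : χ' ^ 3 = 1 := by
    rw [show χ' ^ 3 = (χ ^ 3).ringHomComp (f.comp φ) from MulChar.ringHomComp_pow .., hχ,
      MulChar.ringHomComp_one]
  have hχ1' : χ' ≠ 1 := by
    intro h
    apply hχ1
    refine MulChar.ext fun u => ?_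
    have hu := DFunLike.congr_fun h (u : ZMod q)
    rw [MulChar.one_apply u.isUnit] at hu ⊢
    exact eq_one_of_map_eq_one (three_ne_zero_of_charP l hl3) (f.comp φ)
      (mulChar_pow_three_apply hχ u.ne_zero) hu
  have key := jacobiSum_div_pow hlq hl3 hχ' hχ1' ψ.prim
  rw [MulChar.ringHomComp_inv, jacobiSum_ringHomComp, jacobiSum_ringHomComp,
    ← star_jacobiSum hχ] at key
  rw [map_cubicSymbol, cubicSymbol, key]
  rfl

/-- Data witnessing cubic reciprocity for `z`: a multiplicative function `X` modulo the norm of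
`z`, with cubic values, such that `(z / ℓ)₃ = X ℓ` for all primes `ℓ ≠ 3` prime to `z`. -/
structure IsReciprocal (z : EisensteinInt) (X : ℤ →* EisensteinInt) : Prop where
  congr : ∀ m n : ℤ, m ≡ n [ZMOD QuadraticAlgebra.norm z] → X m = X n
  pow_three : ∀ n : ℤ, IsCoprime n (QuadraticAlgebra.norm z) → X n ^ 3 = 1
  cubicSymbol_eq : ∀ l : ℕ, l.Prime → l ≠ 3 → ¬ (l : ℤ) ∣ QuadraticAlgebra.norm z →
    ∀ (k : Type) [Field k] [CharP k l] (φ : EisensteinInt →+* k), cubicSymbol φ l z = φ (X l)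

theorem IsReciprocal.mul {z w : EisensteinInt} {X Y : ℤ →* EisensteinInt}
    (hz : IsReciprocal z X) (hw : IsReciprocal w Y) : IsReciprocal (z * w) (X * Y) where
  congr m n h := by
    rw [map_mul] at h
    rw [MonoidHom.mul_apply, MonoidHom.mul_apply, hz.congr m n h.of_mul_right,
      hw.congr m n h.of_mul_left]
  pow_three n h := by
    rw [map_mul] at h
    rw [MonoidHom.mul_apply, mul_pow, hz.pow_three n h.of_mul_right_left,
      hw.pow_three n h.of_mul_right_right, one_mul]
  cubicSymbol_eq l hl hl3 h k _ _ φ := by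
    rw [map_mul] at h
    rw [cubicSymbol_mul, hz.cubicSymbol_eq l hl hl3 (fun h' => h (h'.mul_right _)) k φ,
      hw.cubicSymbol_eq l hl hl3 (fun h' => h (h'.mul_left _)) k φ, MonoidHom.mul_apply, map_mul]

theorem isReciprocal_intCast (n : ℤ) : IsReciprocal (n : EisensteinInt) 1 where
  congr _ _ _ := rfl
  pow_three _ _ := by simp
  cubicSymbol_eq l hl hl3 h k _ _ φ := by
    rw [MonoidHom.one_apply, map_one]
    refine cubicSymbol_eq_one φ l (by simp) ?_
    rw [map_intCast, Ne, CharP.intCast_eq_zero_iff k l]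
    exact fun h' => h (by rw [norm_intCast]; exact h'.trans (dvd_pow_self _ two_ne_zero))

theorem exists_norm_eq_prime_isReciprocal {q : ℕ} (hq : q.Prime) (hq3 : q % 3 = 1) :
    ∃ π : EisensteinInt, 3 ∣ π.im ∧ QuadraticAlgebra.norm π = q ∧ (∃ X, IsReciprocal π X) ∧
      ∃ X, IsReciprocal (star π) X := by
  have : Fact q.Prime := ⟨hq⟩
  obtain ⟨χ, hχ⟩ := MulChar.exists_mulChar_orderOf (ZMod q) (n := 3)
    (by rw [ZMod.card]; omega) isPrimitiveRoot_omega
  have hχ3 : χ ^ 3 = 1 := hχ ▸ pow_orderOf_eq_one χ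
  have hχ1 : χ ≠ 1 := by rintro rfl; simp at hχ
  have key : ∀ χ : MulChar (ZMod q) EisensteinInt, χ ^ 3 = 1 → χ ≠ 1 →
      ∃ X, IsReciprocal (jacobiSum χ χ) X := fun χ hχ3 hχ1 =>
    ⟨(χ.toMonoidHom).comp (Int.castRingHom (ZMod q)).toMonoidHom,
      { congr := fun m n h => by
          rw [norm_jacobiSum hχ3 hχ1] at h
          exact congrArg χ ((ZMod.intCast_eq_intCast_iff m n q).mpr h)
        pow_three := fun n h => by
          rw [norm_jacobiSum hχ3 hχ1] at h
          refine mulChar_pow_three_apply hχ3 (a := (n : ZMod q)) ?_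
          rw [Ne, ZMod.intCast_zmod_eq_zero_iff_dvd]
          exact fun h' => (Nat.prime_iff_prime_int.mp hq).not_isUnit (h.isUnit_of_dvd' h' dvd_rfl)
        cubicSymbol_eq := fun l hl hl3 h k _ _ φ => by
          rw [norm_jacobiSum hχ3 hχ1] at h
          have : Fact l.Prime := ⟨hl⟩
          rw [cubicSymbol_jacobiSum (by rintro rfl; exact h dvd_rfl) hl3 hχ3 hχ1]
          simp }⟩
  refine ⟨jacobiSum χ χ, three_dvd_im_jacobiSum hq3 hχ3, norm_jacobiSum hχ3 hχ1,
    key χ hχ3 hχ1, ?_⟩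
  rw [star_jacobiSum hχ3]
  exact key _ (by rw [inv_pow, hχ3, inv_one]) (inv_ne_one.mpr hχ1)

theorem intCast_dvd_of_dvd {q : ℕ} (hq : q.Prime) {w : EisensteinInt} (him : (q : ℤ) ∣ w.im)
    (hn : (q : ℤ) ∣ QuadraticAlgebra.norm w) : ((q : ℤ) : EisensteinInt) ∣ w := by
  have hre : (q : ℤ) ∣ w.re := by
    rw [norm_eq] at hn
    refine (Nat.prime_iff_prime_int.mp hq).dvd_of_dvd_pow (n := 2) ?_
    have := (hn.add (him.mul_left w.re)).sub (him.mul_left w.im)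
    convert this using 1
    ring
  obtain ⟨a, ha⟩ := hre
  obtain ⟨b, hb⟩ := him
  exact ⟨⟨a, b⟩, by ext <;> simp [ha, hb]⟩

theorem dvd_or_star_dvd_of_norm_eq_prime {q : ℕ} (hq : q.Prime) {π z : EisensteinInt}
    (hπ : QuadraticAlgebra.norm π = q) (hz : (q : ℤ) ∣ QuadraticAlgebra.norm z) :
    π ∣ z ∨ star π ∣ z := by
  have hπ0 : π ≠ 0 := by
    rintro rfl
    rw [QuadraticAlgebra.norm_zero] at hπ
    exact hq.ne_zero (by exact_mod_cast hπ.symm)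
  have hππ : π * star π = ((q : ℤ) : EisensteinInt) := by rw [mul_star_eq_norm, hπ]
  have hprod : (q : ℤ) ∣ (z * star π).im * (z * π).im := by
    have : (z * star π).im * (z * π).im =
        z.im ^ 2 * QuadraticAlgebra.norm π - π.im ^ 2 * QuadraticAlgebra.norm z := by
      rw [norm_eq, norm_eq]
      simp
      ring
    rw [this, hπ]
    exact (Dvd.intro_left _ rfl).sub (hz.mul_left _)
  rcases (Nat.prime_iff_prime_int.mp hq).dvd_or_dvd hprod with h | h
  · left
    obtain ⟨w, hw⟩ := intCast_dvd_of_dvd hq h (by rw [map_mul]; exact hz.mul_right _)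
    refine ⟨w, mul_right_cancel₀ (star_ne_zero.mpr hπ0) ?_⟩
    rw [hw, ← hππ]
    ring
  · right
    obtain ⟨w, hw⟩ := intCast_dvd_of_dvd hq h (by rw [map_mul]; exact hz.mul_right _)
    refine ⟨w, mul_right_cancel₀ hπ0 ?_⟩
    rw [hw, ← hππ]
    ring

theorem intCast_dvd_of_dvd_norm {q : ℕ} (hq : q.Prime) (hq3 : q % 3 = 2) {z : EisensteinInt}
    (hz : (q : ℤ) ∣ QuadraticAlgebra.norm z) : ((q : ℤ) : EisensteinInt) ∣ z := by
  have : Fact q.Prime := ⟨hq⟩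
  refine intCast_dvd_of_dvd hq ?_ hz
  rw [norm_eq] at hz
  rw [← ZMod.intCast_zmod_eq_zero_iff_dvd] at hz ⊢
  push_cast at hz
  by_contra hb
  generalize ((z.re : ℤ) : ZMod q) = a at *
  generalize ((z.im : ℤ) : ZMod q) = b at *
  have hw : (a / b) ^ 2 - a / b + 1 = 0 := by
    field_simp
    linear_combination hz
  generalize a / b = u at hw
  have hu3 : u ^ 3 = -1 := by linear_combination (u + 1) * hw
  have hu0 : u ≠ 0 := by rintro rfl; simp at hw
  have hfermat := ZMod.pow_card_sub_one_eq_one hu0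
  obtain ⟨m, rfl⟩ : ∃ m, q = 3 * m + 2 := ⟨q / 3, by omega⟩
  rw [show 3 * m + 2 - 1 = 3 * m + 1 by omega, pow_succ, pow_mul, hu3] at hfermat
  have h3 : ((3 : ℕ) : ZMod (3 * m + 2)) ≠ 0 := by
    rw [Ne, ZMod.natCast_eq_zero_iff, Nat.prime_dvd_prime_iff_eq hq Nat.prime_three]
    omega
  apply h3
  push_cast
  rcases neg_one_pow_eq_or (ZMod (3 * m + 2)) m with h | h <;> rw [h] at hfermat
  · rw [one_mul] at hfermat
    subst hfermat
    have h2 : (2 : ZMod (3 * m + 2)) = 0 := by linear_combination hu3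
    linear_combination hw + h2
  · obtain rfl : u = -1 := by linear_combination -hfermat
    linear_combination hw

theorem three_dvd_of_dvd_mul {z w : EisensteinInt} (hz : 3 ∣ z.im) (him : 3 ∣ (z * w).im)
    (hre : ¬ 3 ∣ (z * w).re) : 3 ∣ w.im ∧ ¬ 3 ∣ w.re := by
  simp only [re_mul, im_mul] at him hre
  obtain ⟨c, hc⟩ := hz
  obtain ⟨f, hf⟩ := him
  rw [hc] at hf hre
  have hzre : ¬ 3 ∣ z.re := by
    rintro ⟨e, he⟩
    exact hre ⟨e * w.re - c * w.im, by rw [he]; ring⟩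
  have h1 : (3 : ℤ) ∣ z.re * w.im :=
    ⟨f - c * w.re + c * w.im, by linear_combination hf⟩
  refine ⟨(Int.prime_three.dvd_or_dvd h1).resolve_left hzre, ?_⟩
  rintro ⟨e, he⟩
  exact hre ⟨z.re * e - c * w.im, by rw [he]; ring⟩

theorem exists_isReciprocal (z : EisensteinInt) (him : 3 ∣ z.im) (hre : ¬ 3 ∣ z.re) :
    ∃ X, IsReciprocal z X := by
  induction hN : (QuadraticAlgebra.norm z).natAbs using Nat.strong_induction_on generalizing z with
  | _ N ih =>
  have step : ∀ (q : ℕ) (π w : EisensteinInt), q.Prime → 3 ∣ π.im →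
      (q : ℤ) ∣ QuadraticAlgebra.norm π → (∃ X, IsReciprocal π X) → z = π * w →
      ∃ X, IsReciprocal z X := by
    rintro q π w hq hπ hqπ ⟨X, hX⟩ rfl
    obtain ⟨h1, h2⟩ := three_dvd_of_dvd_mul hπ him hre
    obtain ⟨Y, hY⟩ := ih _ (by
      rw [← hN, map_mul, Int.natAbs_mul]
      have h0 : 0 < (QuadraticAlgebra.norm w).natAbs := by
        rw [Int.natAbs_pos]
        intro h
        rw [norm_eq_zero h] at h2
        simp at h2
      have h1 : 2 ≤ (QuadraticAlgebra.norm π).natAbs := by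
        refine hq.two_le.trans (Nat.le_of_dvd ?_ (Int.natCast_dvd.mp hqπ))
        rw [Int.natAbs_pos]
        intro h
        rw [norm_eq_zero h] at hre
        simp at hre
      nlinarith) w h1 h2 rfl
    exact ⟨_, hX.mul hY⟩
  by_cases h1 : N = 1
  · have hn : QuadraticAlgebra.norm z = 1 := by
      have : 0 ≤ QuadraticAlgebra.norm z := by
        rw [norm_eq]; nlinarith [sq_nonneg (z.re - z.im), sq_nonneg z.re, sq_nonneg z.im]
      omega
    have hz0 : z.im = 0 := by
      obtain ⟨c, hc⟩ := him
      rw [norm_eq, hc] at hn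
      have : c = 0 := by
        by_contra h
        have : 1 ≤ c ^ 2 := by
          have := sq_nonneg c
          have : c ^ 2 ≠ 0 := pow_ne_zero 2 h
          omega
        nlinarith [sq_nonneg (2 * z.re - 3 * c)]
      rw [hc, this, mul_zero]
    have : z = (z.re : ℤ) := by ext <;> simp [hz0]
    rw [this]
    exact ⟨1, isReciprocal_intCast _⟩
  · obtain ⟨q, hq, hqN⟩ := Nat.exists_prime_and_dvd h1
    rw [← hN, ← Int.natCast_dvd] at hqN
    have hq3 : q % 3 ≠ 0 := by
      intro h
      have : (3 : ℤ) ∣ QuadraticAlgebra.norm z :=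
        (Int.natCast_dvd_natCast.mpr (Nat.dvd_of_mod_eq_zero h)).trans hqN
      rw [norm_eq] at this
      refine hre (Int.prime_three.dvd_of_dvd_pow (n := 2) ?_)
      have := (this.add (him.mul_left z.re)).sub (him.mul_left z.im)
      convert this using 1
      ring
    rcases (by omega : q % 3 = 1 ∨ q % 3 = 2) with h | h
    · obtain ⟨π, hπ, hn, hX, hX'⟩ := exists_norm_eq_prime_isReciprocal hq h
      rcases dvd_or_star_dvd_of_norm_eq_prime hq hn hqN with ⟨w, hw⟩ | ⟨w, hw⟩
      · exact step q π w hq hπ (by rw [hn]) hX hw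
      · exact step q (star π) w hq (by simpa using hπ)
          (by rw [QuadraticAlgebra.norm_star, hn]) hX' hw
    · obtain ⟨w, hw⟩ := intCast_dvd_of_dvd_norm hq h hqN
      refine step q _ w hq (by simp) ?_ ⟨1, isReciprocal_intCast _⟩ hw
      rw [norm_intCast]
      exact dvd_pow_self _ two_ne_zero

theorem IsReciprocal.neg_one {z : EisensteinInt} {X : ℤ →* EisensteinInt}
    (hX : IsReciprocal z X) : X (-1) = 1 := by
  have h3 := hX.pow_three (-1) isCoprime_one_left.neg_left
  have h2 : X (-1) ^ 2 = 1 := by rw [← map_pow, neg_one_sq, map_one]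
  rw [pow_succ, h2, one_mul] at h3
  exact h3

theorem exists_ringHom_field (l : ℕ) [Fact l.Prime] :
    ∃ (k : Type) (_ : Field k) (_ : CharP k l), Nonempty (EisensteinInt →+* k) := by
  let k := AlgebraicClosure (ZMod l)
  obtain ⟨u, hu⟩ := IsAlgClosed.exists_root (Polynomial.X ^ 2 + Polynomial.X + 1 : Polynomial k)
    (by
      rw [show (Polynomial.X ^ 2 + Polynomial.X + 1 : Polynomial k).degree = 2 by compute_degree!]
      norm_num)
  exact ⟨k, inferInstance, charP_of_injective_algebraMap (algebraMap (ZMod l) k).injective l,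
    ⟨homOfRoot u (by simpa using hu)⟩⟩

theorem map_star_eq_of_dvd_im {l : ℕ} {z : EisensteinInt} (h : (l : ℤ) ∣ z.im) {k : Type*}
    [Field k] [CharP k l] (φ : EisensteinInt →+* k) : φ (star z) = φ z := by
  obtain ⟨c, hc⟩ := h
  have : z = star z + ((l : ℤ) : EisensteinInt) * ⟨c, 2 * c⟩ := by
    ext <;> simp [hc]
    ring
  conv_rhs => rw [this, map_add, map_mul, map_intCast, Int.cast_natCast, CharP.cast_eq_zero,
    zero_mul, add_zero]

theorem map_ne_zero_of_not_dvd_norm {l : ℕ} {z : EisensteinInt}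
    (h : ¬ (l : ℤ) ∣ QuadraticAlgebra.norm z) {k : Type*} [Field k] [CharP k l]
    (φ : EisensteinInt →+* k) : φ z ≠ 0 := by
  intro h0
  have := congrArg φ (mul_star_eq_norm z)
  rw [map_mul, h0, zero_mul, map_intCast, eq_comm, CharP.intCast_eq_zero_iff k l] at this
  exact h this

theorem IsReciprocal.eq_one_of_dvd_im {z : EisensteinInt} {X : ℤ →* EisensteinInt}
    (hX : IsReciprocal z X) (n : ℕ) (h3 : ¬ 3 ∣ n) (hn : (n : ℤ) ∣ z.im)
    (hc : IsCoprime (n : ℤ) (QuadraticAlgebra.norm z)) : X n = 1 := by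
  induction n using Nat.recOnMul with
  | zero => exact absurd (dvd_zero 3) h3
  | one => simp
  | prime l hl =>
    have : Fact l.Prime := ⟨hl⟩
    have hl3 : l ≠ 3 := by rintro rfl; exact h3 dvd_rfl
    have hdvd : ¬ (l : ℤ) ∣ QuadraticAlgebra.norm z := fun h =>
      (Nat.prime_iff_prime_int.mp hl).not_isUnit (hc.isUnit_of_dvd' dvd_rfl h)
    obtain ⟨k, _, _, ⟨φ⟩⟩ := exists_ringHom_field l
    refine eq_one_of_map_eq_one (three_ne_zero_of_charP l hl3) φ (hX.pow_three _ hc) ?_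
    rw [← hX.cubicSymbol_eq l hl hl3 hdvd k φ]
    exact cubicSymbol_eq_one φ l (map_star_eq_of_dvd_im hn φ) (map_ne_zero_of_not_dvd_norm hdvd φ)
  | mul a b iha ihb =>
    push_cast at hn hc ⊢
    rw [map_mul, iha (fun h => h3 (h.mul_right _)) ((dvd_mul_right _ _).trans hn)
      hc.of_mul_left_left, ihb (fun h => h3 (h.mul_left _)) ((dvd_mul_left _ _).trans hn)
      hc.of_mul_left_right, one_mul]

theorem IsReciprocal.eq_one_of_norm_eq {z : EisensteinInt} {X : ℤ →* EisensteinInt}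
    (hX : IsReciprocal z X) {b c : ℤ} (hb : b ∣ z.im) (h3 : ¬ 3 ∣ b) (hbc : IsCoprime b c)
    (hn : QuadraticAlgebra.norm z = c + b ^ 2) : X c = 1 := by
  have hbn : IsCoprime b (QuadraticAlgebra.norm z) := by
    rw [hn, pow_two]
    exact hbc.add_mul_left_right b
  have hX1 : X b.natAbs = 1 := by
    refine hX.eq_one_of_dvd_im _ ?_ (Int.natAbs_dvd.mpr hb) ?_
    · rwa [← Int.natCast_dvd]
    · rw [Int.natCast_natAbs]
      exact hbn.abs_left
  have hcb : c ≡ -1 * (b.natAbs : ℤ) ^ 2 [ZMOD QuadraticAlgebra.norm z] := by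
    rw [Int.modEq_comm, Int.modEq_iff_dvd, hn]
    exact ⟨1, by rw [Int.natAbs_pow_two]; ring⟩
  rw [hX.congr _ _ hcb, map_mul, map_pow, hX.neg_one, hX1, one_pow, one_mul]

theorem exists_isReciprocal_of_norm_eq {p : ℕ} (hp : p.Prime) {z : EisensteinInt}
    {b m : ℤ} (him : z.im = -3 * b)
    (hn : QuadraticAlgebra.norm z = 27 * m ^ 2 * p + b ^ 2) (h3 : ¬ 3 ∣ b) (hpb : ¬ (p : ℤ) ∣ b)
    (hbm : IsCoprime b m) :
    ∃ X, IsReciprocal z X ∧ X p ^ 3 = 1 ∧ X m ^ 3 = 1 ∧ X p * X m ^ 2 = 1 ∧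
      ¬ (p : ℤ) ∣ QuadraticAlgebra.norm z := by
  have hp' := Nat.prime_iff_prime_int.mp hp
  have hre : ¬ 3 ∣ z.re := by
    rintro ⟨e, he⟩
    rw [norm_eq, him, he] at hn
    refine h3 (Int.prime_three.dvd_of_dvd_pow (n := 2)
      ⟨3 * e ^ 2 + 3 * e * b + 3 * b ^ 2 - 9 * m ^ 2 * p, ?_⟩)
    linear_combination -hn
  obtain ⟨X, hX⟩ := exists_isReciprocal z ⟨-b, by rw [him]; ring⟩ hre
  have hb3 : IsCoprime b 3 := ((Int.prime_three.coprime_iff_not_dvd).mpr h3).symm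
  have hbp : IsCoprime b p := ((hp'.coprime_iff_not_dvd).mpr hpb).symm
  have key : ∀ n : ℤ, IsCoprime b n → n ∣ 27 * m ^ 2 * p →
      IsCoprime n (QuadraticAlgebra.norm z) := by
    rintro n h ⟨e, he⟩
    rw [hn, he, add_comm]
    exact (IsCoprime.pow_right h.symm).add_mul_left_right e
  have k3 := key 3 hb3 ⟨9 * m ^ 2 * p, by ring⟩
  have km := key m hbm ⟨27 * m * p, by ring⟩
  have kp := key p hbp ⟨27 * m ^ 2, by ring⟩
  refine ⟨X, hX, hX.pow_three _ kp, hX.pow_three _ km, ?_, fun h =>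
    hp'.not_isUnit (kp.isUnit_of_dvd' dvd_rfl h)⟩
  have h := hX.eq_one_of_norm_eq (b := b) ⟨-3, by rw [him]; ring⟩ h3
    (((hb3.pow_right (n := 3)).mul_right (hbm.pow_right (n := 2))).mul_right hbp)
    (hn.trans (by ring))
  rw [map_mul, map_mul, map_pow, map_pow, hX.pow_three _ k3, one_mul, mul_comm] at h
  exact h

theorem IsReciprocal.apply_two_ne_one {z : EisensteinInt} {X : ℤ →* EisensteinInt}
    (hX : IsReciprocal z X) (hre : 2 ∣ z.re) (him : ¬ 2 ∣ z.im) : X 2 ≠ 1 := by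
  intro h
  have : Fact (Nat.Prime 2) := ⟨Nat.prime_two⟩
  obtain ⟨k, _, _, ⟨φ⟩⟩ := exists_ringHom_field 2
  have hn : ¬ ((2 : ℕ) : ℤ) ∣ QuadraticAlgebra.norm z := by
    rw [norm_eq]
    obtain ⟨a, ha⟩ := hre
    rintro ⟨b, hb⟩
    refine him (Int.prime_two.dvd_of_dvd_pow (n := 2) ⟨b - 2 * a ^ 2 + a * z.im, ?_⟩)
    rw [ha] at hb
    push_cast at hb
    linear_combination hb
  have h2 := hX.cubicSymbol_eq 2 Nat.prime_two (by norm_num) hn k φ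
  rw [Nat.cast_two, h, map_one, cubicSymbol, if_neg (by norm_num), pow_one,
    div_eq_one_iff_eq (map_ne_zero_of_not_dvd_norm hn φ)] at h2
  have h3 : (z - star z) ^ 2 = ((-3 * z.im ^ 2 : ℤ) : EisensteinInt) := by
    ext <;> simp [pow_two]
    all_goals ring
  have h4 := congrArg φ h3
  rw [map_pow, map_sub, h2, sub_self, zero_pow two_ne_zero, map_intCast, eq_comm,
    CharP.intCast_eq_zero_iff k 2] at h4
  refine him (Int.prime_two.dvd_of_dvd_pow (n := 2) ?_)
  push_cast at h4
  omega

/-- A cubic reciprocity certificate for the prime `p`: an element `z` of norm `27m²p + b²` with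
imaginary part `-3b`, whose residue symbol at `p` is the image of `c`. -/
structure IsCertificate (p : ℕ) (z c : EisensteinInt) (b m : ℤ) : Prop where
  im_eq : z.im = -3 * b
  norm_eq : QuadraticAlgebra.norm z = 27 * m ^ 2 * p + b ^ 2
  not_dvd : ¬ (p : ℤ) ∣ b
  pow_three : c ^ 3 = 1
  cubicSymbol_eq : ∀ (k : Type) [Field k] [CharP k p] (φ : EisensteinInt →+* k),
    cubicSymbol φ p z = φ c

theorem dvd_of_dvd_twentyseven_mul_sq {p : ℕ} (hp : p.Prime) (hp3 : p % 3 = 1) {y : ℤ}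
    (h : (p : ℤ) ∣ 27 * y ^ 2) : (p : ℤ) ∣ y := by
  have hp' := Nat.prime_iff_prime_int.mp hp
  rcases hp'.dvd_or_dvd h with h | h
  · have h : p ∣ 3 ^ 3 := by exact_mod_cast h
    rw [(Nat.prime_dvd_prime_iff_eq hp Nat.prime_three).mp (hp.dvd_of_dvd_pow h)] at hp3
    norm_num at hp3
  · exact hp'.dvd_of_dvd_pow h

theorem not_sq_dvd_of_prime {p : ℕ} (hp : p.Prime) {n : ℤ} (h : (p : ℤ) = p ^ 2 * n) : False := by
  have hp' := Nat.prime_iff_prime_int.mp hp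
  refine hp'.not_isUnit (IsUnit.of_mul_eq_one n (mul_left_cancel₀ hp'.ne_zero ?_))
  linear_combination -h

theorem exists_isCertificate_of_principal {p : ℕ} (hp : p.Prime) (hp3 : p % 3 = 1) {x y : ℤ}
    (h : (p : ℤ) = x ^ 2 + x * y + 6 * y ^ 2) :
    ∃ z b m, IsCertificate p z 1 b m := by
  have hp' := Nat.prime_iff_prime_int.mp hp
  have h3 : ¬ 3 ∣ 2 * x + 3 * y := by
    intro h'
    obtain ⟨e, rfl⟩ : 3 ∣ x := by omega
    have : (3 : ℤ) ∣ p := ⟨3 * e ^ 2 + e * y + 2 * y ^ 2, by rw [h]; ring⟩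
    omega
  have hpb : ¬ (p : ℤ) ∣ 2 * x + 3 * y := by
    rintro ⟨e, he⟩
    have hy : (p : ℤ) ∣ y := dvd_of_dvd_twentyseven_mul_sq hp hp3
      ⟨4 - (2 * x + 3 * y) * e + 4 * y * e, by
        linear_combination -4 * h - (2 * x + 3 * y - 4 * y) * he⟩
    obtain ⟨f, rfl⟩ := hy
    have hx : (p : ℤ) ∣ 2 * x := ⟨e - 3 * f, by linear_combination he⟩
    have hx : (p : ℤ) ∣ x := by
      refine (hp'.dvd_or_dvd hx).resolve_left fun h2 => ?_
      have h2 : p ∣ 2 := by exact_mod_cast h2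
      have := (Nat.prime_dvd_prime_iff_eq hp Nat.prime_two).mp h2
      omega
    obtain ⟨g, rfl⟩ := hx
    exact not_sq_dvd_of_prime hp (n := g ^ 2 + g * f + 6 * f ^ 2) (by linear_combination h)
  let z : EisensteinInt := ⟨-(x + 15 * y), -3 * (2 * x + 3 * y)⟩
  have hn : QuadraticAlgebra.norm z = 27 * 1 ^ 2 * p + (2 * x + 3 * y) ^ 2 := by
    rw [norm_eq, h]
    ring
  obtain ⟨X, hX, -, -, h1, hpn⟩ :=
    exists_isReciprocal_of_norm_eq hp rfl hn h3 hpb isCoprime_one_right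
  rw [map_one, one_pow, mul_one] at h1
  refine ⟨z, _, _, rfl, hn, hpb, one_pow 3, fun k _ _ φ => ?_⟩
  rw [hX.cubicSymbol_eq p hp (by omega) hpn k φ, h1]

theorem exists_isCertificate_of_nonprincipal {p : ℕ} (hp : p.Prime) (hp3 : p % 3 = 1) {x y : ℤ}
    (h : (p : ℤ) = 4 * x ^ 2 + 3 * x * y + 2 * y ^ 2) :
    ∃ z b m c, c ≠ 1 ∧ IsCertificate p z c b m := by
  have hp' := Nat.prime_iff_prime_int.mp hp
  have hodd : ¬ 2 ∣ y := by
    rintro ⟨e, rfl⟩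
    have h2 : p ∣ 2 := by
      have : (2 : ℤ) ∣ p := ⟨2 * x ^ 2 + 3 * x * e + 4 * e ^ 2, by rw [h]; ring⟩
      rw [← (Nat.prime_dvd_prime_iff_eq Nat.prime_two hp).mp (by exact_mod_cast this)]
    have := (Nat.prime_dvd_prime_iff_eq hp Nat.prime_two).mp h2
    omega
  have h3 : ¬ 3 ∣ 8 * x + 5 * y := by
    intro h'
    obtain ⟨e, he⟩ : 3 ∣ x + y := by omega
    obtain rfl : x = 3 * e - y := by omega
    have : (3 : ℤ) ∣ p := ⟨12 * e ^ 2 - 5 * e * y + y ^ 2, by rw [h]; ring⟩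
    omega
  have hpb : ¬ (p : ℤ) ∣ 8 * x + 5 * y := by
    rintro ⟨e, he⟩
    have hy : (p : ℤ) ∣ y := dvd_of_dvd_twentyseven_mul_sq hp hp3
      ⟨16 - (8 * x + 5 * y) * e + 4 * y * e, by
        linear_combination -16 * h - (8 * x + 5 * y - 4 * y) * he⟩
    obtain ⟨f, rfl⟩ := hy
    have hx : (p : ℤ) ∣ 2 ^ 3 * x := ⟨e - 5 * f, by linear_combination he⟩
    have hx : (p : ℤ) ∣ x := by
      refine (hp'.dvd_or_dvd hx).resolve_left fun h2 => ?_
      have h2 : p ∣ 2 := hp.dvd_of_dvd_pow (n := 3) (by exact_mod_cast h2)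
      have := (Nat.prime_dvd_prime_iff_eq hp Nat.prime_two).mp h2
      omega
    obtain ⟨g, rfl⟩ := hx
    exact not_sq_dvd_of_prime hp (n := 4 * g ^ 2 + 3 * g * f + 2 * f ^ 2)
      (by linear_combination h)
  let z : EisensteinInt := ⟨-(4 * x + 16 * y), -3 * (8 * x + 5 * y)⟩
  have hn : QuadraticAlgebra.norm z = 27 * 2 ^ 2 * p + (8 * x + 5 * y) ^ 2 := by
    rw [norm_eq, h]
    ring
  obtain ⟨X, hX, hp1, h2, h1, hpn⟩ := exists_isReciprocal_of_norm_eq hp rfl hn h3 hpb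
    ((Int.prime_two.coprime_iff_not_dvd).mpr (by omega)).symm
  refine ⟨z, _, _, X p, ?_, rfl, hn, hpb, hp1, fun k _ _ φ => ?_⟩
  · intro h0
    refine hX.apply_two_ne_one (by simp only [z]; omega) (by simp only [z]; omega) ?_
    rw [h0, one_mul] at h1
    rw [pow_succ, h1, one_mul] at h2
    exact h2
  · rw [hX.cubicSymbol_eq p hp (by omega) hpn k φ]

theorem form_reduction {p : ℕ} (hp : p.Prime) (hp2 : p ≠ 2) (hres : IsSquare (-23 : ZMod p)) :
    (∃ x y : ℤ, (p : ℤ) = x ^ 2 + x * y + 6 * y ^ 2) ∨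
      ∃ x y : ℤ, (p : ℤ) = 4 * x ^ 2 + 3 * x * y + 2 * y ^ 2 := by
  have hp' := Nat.prime_iff_prime_int.mp hp
  let S : ℕ → Prop := fun a => 0 < a ∧ ∃ b c x y : ℤ, b ^ 2 + 23 = 4 * a * c ∧
    (p : ℤ) = a * x ^ 2 + b * x * y + c * y ^ 2
  have hS : ∃ a, S a := by
    obtain ⟨s, hs⟩ := hres
    obtain ⟨b, rfl⟩ := ZMod.intCast_surjective s
    have hdvd : (p : ℤ) ∣ b ^ 2 + 23 := by
      rw [← ZMod.intCast_zmod_eq_zero_iff_dvd]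
      push_cast
      linear_combination -hs
    obtain ⟨b, hb, hdvd⟩ : ∃ b : ℤ, b % 2 = 1 ∧ (p : ℤ) ∣ b ^ 2 + 23 := by
      rcases Int.emod_two_eq_zero_or_one b with h | h
      · refine ⟨b + p, ?_, ?_⟩
        · have := hp.eq_two_or_odd
          omega
        · rw [show (b + p) ^ 2 + 23 = b ^ 2 + 23 + p * (2 * b + p) by ring]
          exact hdvd.add (dvd_mul_right _ _)
      · exact ⟨b, h, hdvd⟩
    obtain ⟨c, hc⟩ : 4 * (p : ℤ) ∣ b ^ 2 + 23 := by
      have h4 : (4 : ℤ) ∣ b ^ 2 + 23 := by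
        obtain ⟨e, rfl⟩ : ∃ e, b = 2 * e + 1 := ⟨b / 2, by omega⟩
        exact ⟨e ^ 2 + e + 6, by ring⟩
      refine IsCoprime.mul_dvd ?_ h4 hdvd
      rw [show (4 : ℤ) = 2 ^ 2 by norm_num]
      refine IsCoprime.pow_left ((Int.prime_two.coprime_iff_not_dvd).mpr ?_)
      have := hp.eq_two_or_odd
      omega
    exact ⟨p, hp.pos, b, c, 1, 0, hc, by ring⟩
  classical
  obtain ⟨ha, b, c, x, y, hd, hrep⟩ := Nat.find_spec hS
  have hmin := fun n => Nat.find_min' hS (m := n)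
  generalize Nat.find hS = a at *
  -- shift `b` into the range `(-a, a]`
  obtain ⟨b, c, x, y, hd, hrep, hb1, hb2⟩ : ∃ b c x y : ℤ, b ^ 2 + 23 = 4 * a * c ∧
      (p : ℤ) = a * x ^ 2 + b * x * y + c * y ^ 2 ∧ -a ≤ b ∧ b ≤ a := by
    let k := (b + a) / (2 * a)
    have e1 := Int.emod_add_mul_ediv (b + a) (2 * a)
    have e2 := Int.emod_nonneg (b + a) (b := 2 * a) (by omega)
    have e3 := Int.emod_lt_of_pos (b + a) (b := 2 * a) (by omega)
    refine ⟨b - 2 * a * k, a * k ^ 2 - b * k + c, x + k * y, y, ?_, ?_, ?_, ?_⟩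
    · linear_combination hd
    · rw [hrep]; ring
    · linarith
    · linarith
  have hca : (a : ℤ) ≤ c := by
    have hc : 0 < c := by
      by_contra! h
      nlinarith [sq_nonneg b]
    lift c to ℕ using hc.le
    exact_mod_cast hmin c ⟨by omega, -b, a, y, -x, by linear_combination hd, by rw [hrep]; ring⟩
  have ha2 : a ≤ 2 := by
    by_contra! h
    have : (3 : ℤ) ≤ a := by omega
    nlinarith
  interval_cases a
  · have hb : b = -1 ∨ b = 0 ∨ b = 1 := by omega
    left
    rcases hb with rfl | rfl | rfl
    · obtain rfl : c = 6 := by omega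
      exact ⟨x, -y, by rw [hrep]; ring⟩
    · omega
    · obtain rfl : c = 6 := by omega
      exact ⟨x, y, by rw [hrep]; ring⟩
  · have hb : b = -2 ∨ b = -1 ∨ b = 0 ∨ b = 1 ∨ b = 2 := by omega
    right
    rcases hb with rfl | rfl | rfl | rfl | rfl
    · omega
    · obtain rfl : c = 3 := by omega
      exact ⟨y, x - y, by rw [hrep]; push_cast; ring⟩
    · omega
    · obtain rfl : c = 3 := by omega
      exact ⟨-y, x + y, by rw [hrep]; push_cast; ring⟩
    · omega

theorem cubicSymbol_eq_unit_pow {κ : Type} [Field κ] {p : ℕ} [CharP κ p] (hp : p.Prime)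
    (hp3 : p % 3 = 1) (hp23 : p ≠ 23) {r : κ} (hr : r ^ 2 = 69) {z c : EisensteinInt} {b m : ℤ}
    (h : IsCertificate p z c b m) :
    ∃ φ : EisensteinInt →+* κ, φ c = ((25 + 3 * r) / 2) ^ ((p - 1) / 3) := by
  have hchar : ∀ q : ℕ, q.Prime → p ≠ q → (q : κ) ≠ 0 := fun q hq hpq h0 =>
    hpq ((Nat.prime_dvd_prime_iff_eq hp hq).mp ((CharP.cast_eq_zero_iff κ p q).mp h0))
  have h2 : (2 : κ) ≠ 0 := by
    exact_mod_cast hchar 2 Nat.prime_two (by rintro rfl; norm_num at hp3)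
  have h3 : (3 : κ) ≠ 0 := by
    exact_mod_cast hchar 3 Nat.prime_three (by rintro rfl; norm_num at hp3)
  have h23 : (23 : κ) ≠ 0 := by exact_mod_cast hchar 23 (by norm_num) hp23
  have hb : (b : κ) ≠ 0 := by
    rw [Ne, CharP.intCast_eq_zero_iff κ p]
    exact h.not_dvd
  have hn := congrArg (Int.cast : ℤ → κ) h.norm_eq
  rw [EisensteinInt.norm_eq, h.im_eq] at hn
  push_cast at hn
  rw [CharP.cast_eq_zero, mul_zero, zero_add] at hn
  obtain ⟨x, hx⟩ : ∃ x : κ, x = 2 * z.re + 3 * b := ⟨_, rfl⟩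
  have hx2 : x ^ 2 = -23 * (b : κ) ^ 2 := by rw [hx]; linear_combination 4 * hn
  have hx0 : x ≠ 0 := by
    rintro rfl
    have : (23 : κ) * (b : κ) ^ 2 = 0 := by linear_combination hx2
    exact mul_ne_zero h23 (pow_ne_zero 2 hb) this
  obtain ⟨t, ht⟩ : ∃ t : κ, t = r * b / x := ⟨_, rfl⟩
  have htx : t * x = r * b := by rw [ht, div_mul_cancel₀ _ hx0]
  have ht2 : t ^ 2 = -3 := by
    apply mul_right_cancel₀ (pow_ne_zero 2 hx0)
    linear_combination (t * x + r * b) * htx + (b : κ) ^ 2 * hr + 3 * hx2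
  let φ := homOfRoot ((t - 1) / 2) (by field_simp; linear_combination ht2)
  have e1 : φ z = (x - 3 * t * b) / 2 := by
    rw [homOfRoot_apply, hx, h.im_eq]
    push_cast
    field_simp
    ring
  have e2 : φ (star z) = (x + 3 * t * b) / 2 := by
    rw [homOfRoot_apply, hx, re_star, im_star, h.im_eq]
    push_cast
    field_simp
    ring
  have hs : φ (star z) ≠ 0 := by
    intro h0
    have h1 : (b : κ) ^ 2 * (23 - 3 * r) = 0 := by
      rw [e2, div_eq_zero_iff, or_iff_left h2] at h0
      linear_combination -x * h0 + hx2 + 3 * b * htx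
    have h92 : (2 : κ) ^ 2 * 23 * (b : κ) ^ 2 = 0 := by
      linear_combination -(23 + 3 * r) * h1 - 9 * (b : κ) ^ 2 * hr
    exact mul_ne_zero (mul_ne_zero (pow_ne_zero 2 h2) h23) (pow_ne_zero 2 hb) h92
  have hε : φ z / φ (star z) = -((25 + 3 * r) / 2) := by
    rw [div_eq_iff hs, e1, e2]
    field_simp
    apply mul_left_cancel₀ hx0
    linear_combination (27 + 3 * r) * hx2 + (-6 * b + 3 * b * (25 + 3 * r)) * htx +
      9 * (b : κ) ^ 2 * hr
  refine ⟨φ, ?_⟩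
  rw [← h.cubicSymbol_eq κ φ, cubicSymbol, if_pos hp3, hε, Even.neg_pow]
  obtain ⟨j, hj⟩ := hp.even_sub_one (by rintro rfl; norm_num at hp3)
  exact ⟨(p - 1) / 6, by omega⟩

theorem exists_pow_three_eq_iff {κ : Type*} [Field κ] [Finite κ] {p : ℕ} (hκ : Nat.card κ = p)
    (hp3 : p % 3 = 1) {e : κ} (he : e ≠ 0) :
    (∃ c, c ^ 3 = e) ↔ e ^ ((p - 1) / 3) = 1 := by
  have hdiv : 3 * ((p - 1) / 3) = p - 1 := by omega
  classical
  have : Fintype κ := Fintype.ofFinite κ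
  rw [Nat.card_eq_fintype_card] at hκ
  constructor
  · rintro ⟨c, rfl⟩
    have hc : c ≠ 0 := by rintro rfl; simp at he
    rw [← pow_mul, hdiv, ← hκ, FiniteField.pow_card_sub_one_eq_one c hc]
  · intro h
    obtain ⟨g, hg⟩ := IsCyclic.exists_generator (α := κˣ)
    obtain ⟨n, hn⟩ := (mem_powers_iff_mem_zpowers.mpr (hg (Units.mk0 e he)))
    have hn : g ^ n = Units.mk0 e he := hn
    have hord : orderOf g = p - 1 := by
      rw [orderOf_eq_card_of_forall_mem_zpowers hg, Nat.card_eq_fintype_card, Fintype.card_units,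
        hκ]
    have h1 : g ^ (n * ((p - 1) / 3)) = 1 := by
      rw [pow_mul, hn]
      exact Units.ext (by simpa using h)
    obtain ⟨d, hd⟩ := orderOf_dvd_of_pow_eq_one h1
    rw [hord] at hd
    have hpos : 0 < (p - 1) / 3 := by
      have := Fintype.one_lt_card (α := κ)
      omega
    have hn3 : n = d * 3 := Nat.eq_of_mul_eq_mul_right hpos (by rw [hd, mul_assoc, hdiv, mul_comm])
    refine ⟨(g ^ d : κˣ), ?_⟩
    rw [← Units.val_pow_eq_pow_val, ← pow_mul, ← hn3, hn, Units.val_mk0]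

end EisensteinInt

theorem card_eq_of_pow_eq {κ : Type*} [Field κ] [Finite κ] {p : ℕ} [Fact p.Prime] [CharP κ p]
    (h : ∀ x : κ, x ^ p = x) : Nat.card κ = p := by
  have hp : 2 ≤ p := (Fact.out : p.Prime).two_le
  refine le_antisymm ?_ ?_
  · obtain ⟨g, hg⟩ := IsCyclic.exists_generator (α := κˣ)
    have h1 : g ^ (p - 1) = 1 := by
      refine Units.ext (mul_right_cancel₀ g.ne_zero ?_)
      rw [Units.val_pow_eq_pow_val, ← pow_succ, Nat.sub_add_cancel (by omega), h, Units.val_one,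
        one_mul]
    have h2 := Nat.le_of_dvd (by omega) (orderOf_dvd_of_pow_eq_one h1)
    rw [orderOf_eq_card_of_forall_mem_zpowers hg, Nat.card_units] at h2
    omega
  · simpa using Nat.card_le_card_of_injective _ (ZMod.castHom dvd_rfl κ).injective

section Splitting

variable {K : Type*} [Field K]

theorem isGalois_of_adjoin_sqrt_eq_top [NumberField K] {α β : K} {m n : ℚ}
    (hα : α ^ 2 = m) (hβ : β ^ 2 = n)
    (h : adjoin ℚ {α, β} = ⊤) : IsGalois ℚ K := by
  let f : Polynomial ℚ := (Polynomial.X ^ 2 - Polynomial.C m) * (Polynomial.X ^ 2 - Polynomial.C n)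
  have hf : f ≠ 0 := mul_ne_zero (Polynomial.X_pow_sub_C_ne_zero two_pos m)
    (Polynomial.X_pow_sub_C_ne_zero two_pos n)
  have hsplit : ∀ (γ : K) (r : ℚ), γ ^ 2 = r →
      ((Polynomial.X ^ 2 - Polynomial.C r).map (algebraMap ℚ K)).Splits := by
    intro γ r hr
    have : (Polynomial.X ^ 2 - Polynomial.C r).map (algebraMap ℚ K) =
        (Polynomial.X - Polynomial.C γ) * (Polynomial.X + Polynomial.C γ) := by
      simp only [Polynomial.map_sub, Polynomial.map_pow, Polynomial.map_X, Polynomial.map_C,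
        eq_ratCast, ← hr]
      rw [map_pow]
      ring
    rw [this]
    exact (Polynomial.Splits.X_sub_C γ).mul (Polynomial.Splits.X_add_C γ)
  have : f.IsSplittingField ℚ K := by
    rw [isSplittingField_iff_intermediateField]
    refine ⟨?_, ?_⟩
    · rw [Polynomial.map_mul]
      exact (hsplit α m hα).mul (hsplit β n hβ)
    · rw [eq_top_iff, ← h]
      refine adjoin.mono _ _ _ ?_
      rintro x (rfl | rfl) <;> rw [Polynomial.mem_rootSet] <;> refine ⟨hf, ?_⟩ <;> simp [f, hα, hβ]
  have := Normal.of_isSplittingField (E := K) f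
  exact ⟨⟩

variable {p : ℕ} [Fact p.Prime] {P : Ideal (𝓞 K)} [P.IsPrime]

theorem charP_quotient (hP : (p : 𝓞 K) ∈ P) : CharP (𝓞 K ⧸ P) p := by
  have h : ((p : ℕ) : 𝓞 K ⧸ P) = 0 := by
    rw [← map_natCast (Ideal.Quotient.mk P)]
    exact Ideal.Quotient.eq_zero_iff_mem.mpr hP
  have h1 := ringChar.dvd h
  rcases (Nat.dvd_prime Fact.out).mp h1 with h2 | h2
  · have : CharP (𝓞 K ⧸ P) 1 := h2 ▸ ringChar.charP _
    exact absurd (CharP.char_ne_one (𝓞 K ⧸ P) 1) (by simp)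
  · exact h2 ▸ ringChar.charP _

theorem smul_eq_self_of_sq_eq [NumberField K] (hP : (p : 𝓞 K) ∈ P) {σ : Gal(K/ℚ)}
    (hσ : ∀ x : 𝓞 K, Ideal.Quotient.mk P (σ • x) = Ideal.Quotient.mk P x ^ p) {α : 𝓞 K} {m : ℤ}
    (hα : α ^ 2 = m) (hm : ¬ (p : ℤ) ∣ 4 * m) (hsq : IsSquare (m : ZMod p)) : σ • α = α := by
  have := charP_quotient hP
  have h2 : (σ • α) ^ 2 = α ^ 2 := by
    rw [← smul_pow', hα]
    exact map_intCast (MulSemiringAction.toRingHom Gal(K/ℚ) (𝓞 K) σ) m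
  refine (sq_eq_sq_iff_eq_or_eq_neg.mp h2).resolve_right fun hneg => ?_
  have hfix : Ideal.Quotient.mk P α ^ p = Ideal.Quotient.mk P α := by
    obtain ⟨s, hs⟩ := hsq
    have hs2 : Ideal.Quotient.mk P α ^ 2 = (ZMod.castHom dvd_rfl (𝓞 K ⧸ P) s) ^ 2 := by
      rw [← map_pow, hα, ← map_pow, pow_two s, ← hs, map_intCast, map_intCast]
    have hs' : (ZMod.castHom dvd_rfl (𝓞 K ⧸ P) s) ^ p = ZMod.castHom dvd_rfl (𝓞 K ⧸ P) s := by
      rw [← map_pow, ZMod.pow_card]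
    rcases sq_eq_sq_iff_eq_or_eq_neg.mp hs2 with h | h
    · rw [h, hs']
    · rw [h, ← map_neg, ← map_pow, ZMod.pow_card]
  have h0 := hσ α
  rw [hfix, hneg, map_neg] at h0
  have h4 : ((4 * m : ℤ) : 𝓞 K ⧸ P) = 0 := by
    have h5 : ((m : ℤ) : 𝓞 K ⧸ P) = Ideal.Quotient.mk P α ^ 2 := by
      rw [← map_pow, hα, map_intCast]
    push_cast
    rw [h5]
    linear_combination -2 * Ideal.Quotient.mk P α * h0
  rw [CharP.intCast_eq_zero_iff _ p] at h4
  exact hm h4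

theorem card_quotient_of_adjoin_sqrt_eq_top [NumberField K] (hP : (p : 𝓞 K) ∈ P)
    {α β : 𝓞 K} {m n : ℤ}
    (hα : α ^ 2 = m) (hβ : β ^ 2 = n) (h : adjoin ℚ {(α : K), (β : K)} = ⊤)
    (hm : ¬ (p : ℤ) ∣ 4 * m) (hn : ¬ (p : ℤ) ∣ 4 * n) (hm' : IsSquare (m : ZMod p))
    (hn' : IsSquare (n : ZMod p)) : Nat.card (𝓞 K ⧸ P) = p := by
  have hP0 : P ≠ ⊥ := by
    rintro rfl
    exact (Fact.out : p.Prime).ne_zero (by exact_mod_cast Ideal.mem_bot.mp hP)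
  have : P.IsMaximal := Ideal.IsPrime.isMaximal ‹_› hP0
  let _ : Field (𝓞 K ⧸ P) := Ideal.Quotient.field P
  have : Finite (𝓞 K ⧸ P) := Ring.HasFiniteQuotients.finiteQuotient hP0
  have hcharP : CharP (𝓞 K ⧸ P) p := charP_quotient hP
  have := isGalois_of_adjoin_sqrt_eq_top (K := K) (α := α) (β := β) (m := m) (n := n)
    (by rw [← map_pow, hα]; simp) (by rw [← map_pow, hβ]; simp) h
  obtain ⟨σ, hσ⟩ := IsArithFrobAt.exists_of_isInvariant ℤ Gal(K/ℚ) P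
  have hunder : P.under ℤ = Ideal.span {(p : ℤ)} := by
    have hmax : (Ideal.span {(p : ℤ)}).IsMaximal := Int.ideal_span_isMaximal_of_prime p
    refine (hmax.eq_of_le (Ideal.IsPrime.ne_top inferInstance) ?_).symm
    rw [Ideal.span_singleton_le_iff_mem, Ideal.mem_comap]
    simpa using hP
  have hσ' : ∀ x : 𝓞 K, Ideal.Quotient.mk P (σ • x) = Ideal.Quotient.mk P x ^ p := by
    intro x
    have := hσ.mk_apply x
    rwa [hunder, Int.card_ideal_quot] at this
  have hσα := smul_eq_self_of_sq_eq hP hσ' hα hm hm'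
  have hσβ := smul_eq_self_of_sq_eq hP hσ' hβ hn hn'
  have hfix : ∀ x : K, σ x = x := by
    intro x
    have hx : x ∈ adjoin ℚ {(α : K), (β : K)} := h ▸ mem_top
    induction hx using adjoin_induction with
    | mem x hx =>
      rcases hx with rfl | rfl
      · exact congrArg (algebraMap (𝓞 K) K) hσα
      · exact congrArg (algebraMap (𝓞 K) K) hσβ
    | algebraMap x => exact σ.commutes x
    | add x y _ _ hx hy => rw [map_add, hx, hy]
    | inv x _ hx => rw [map_inv₀, hx]
    | mul x y _ _ hx hy => rw [map_mul, hx, hy]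
  have hone : σ = 1 := AlgEquiv.ext hfix
  refine card_eq_of_pow_eq fun x => ?_
  obtain ⟨x, rfl⟩ := Ideal.Quotient.mk_surjective x
  rw [← hσ', hone, one_smul]

end Splitting

theorem isSquare_neg_three {p : ℕ} [Fact p.Prime] (hp3 : p % 3 = 1) :
    IsSquare (-3 : ZMod p) := by
  have h3 : (3 : ZMod p) ≠ 0 :=
    EisensteinInt.three_ne_zero_of_charP p (by rintro rfl; norm_num at hp3)
  obtain ⟨g, hg⟩ := IsCyclic.exists_generator (α := (ZMod p)ˣ)
  have hord : orderOf g = p - 1 := by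
    rw [orderOf_eq_card_of_forall_mem_zpowers hg, Nat.card_eq_fintype_card, ZMod.card_units]
  have hp := (Fact.out : p.Prime).two_le
  obtain ⟨w, hw⟩ : ∃ w : (ZMod p)ˣ, w = g ^ ((p - 1) / 3) := ⟨_, rfl⟩
  have hw3 : (w : ZMod p) ^ 3 = 1 := by
    rw [← Units.val_pow_eq_pow_val, hw, ← pow_mul,
      show (p - 1) / 3 * 3 = orderOf g by omega, pow_orderOf_eq_one, Units.val_one]
  have hw1 : (w : ZMod p) - 1 ≠ 0 := by
    intro h
    have h1 : g ^ ((p - 1) / 3) = 1 := by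
      rw [← hw]
      exact Units.ext (sub_eq_zero.mp h)
    have := Nat.le_of_dvd (by omega) (orderOf_dvd_of_pow_eq_one h1)
    omega
  have hw2 : (w : ZMod p) ^ 2 + w + 1 = 0 :=
    (mul_eq_zero.mp (by linear_combination hw3)).resolve_left hw1
  exact ⟨2 * w + 1, by linear_combination -4 * hw2⟩

theorem Ksqrt69_gen_left_mem : Complex.I * Real.sqrt 3 ∈ Ksqrt69 :=
  subset_adjoin _ _ (Set.mem_insert _ _)

theorem Ksqrt69_gen_right_mem : ((Real.sqrt 69 : ℝ) : ℂ) ∈ Ksqrt69 :=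
  subset_adjoin _ _ (Set.mem_insert_of_mem _ rfl)

theorem exists_integral_sqrt {K : Type*} [Field K] {a : K} {n : ℤ} (h : a ^ 2 = n) :
    ∃ α : 𝓞 K, (α : K) = a ∧ α ^ 2 = n := by
  have ha : IsIntegral ℤ a := IsIntegral.of_pow two_pos (h ▸ isIntegral_intCast n)
  obtain ⟨α, hα⟩ : ∃ α : 𝓞 K, (α : K) = a := ⟨⟨a, ha⟩, rfl⟩
  refine ⟨α, hα, RingOfIntegers.ext ?_⟩
  change algebraMap (𝓞 K) K (α ^ 2) = algebraMap (𝓞 K) K n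
  rw [map_pow, map_intCast]
  rw [← hα] at h
  exact h

theorem exists_generators_Ksqrt69 : ∃ α β : 𝓞 Ksqrt69, α ^ 2 = (-3 : ℤ) ∧ β ^ 2 = (69 : ℤ) ∧
    ((β : Ksqrt69) : ℂ) = Real.sqrt 69 ∧ adjoin ℚ {(α : Ksqrt69), (β : Ksqrt69)} = ⊤ := by
  have h3 : (Complex.I * Real.sqrt 3) ^ 2 = ((-3 : ℤ) : ℂ) := by
    rw [mul_pow, Complex.I_sq, ← Complex.ofReal_pow, Real.sq_sqrt (by norm_num)]
    norm_num
  have h69 : ((Real.sqrt 69 : ℝ) : ℂ) ^ 2 = ((69 : ℤ) : ℂ) := by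
    rw [← Complex.ofReal_pow, Real.sq_sqrt (by norm_num)]
    norm_num
  obtain ⟨α, hα, hα2⟩ := exists_integral_sqrt (K := Ksqrt69) (n := -3)
    (a := ⟨Complex.I * Real.sqrt 3, Ksqrt69_gen_left_mem⟩)
    (Subtype.ext (h3.trans (map_intCast Ksqrt69.val _).symm))
  obtain ⟨β, hβ, hβ2⟩ := exists_integral_sqrt (K := Ksqrt69) (n := 69)
    (a := ⟨Real.sqrt 69, Ksqrt69_gen_right_mem⟩)
    (Subtype.ext (h69.trans (map_intCast Ksqrt69.val _).symm))
  refine ⟨α, β, hα2, hβ2, by rw [hβ], ?_⟩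
  have htop : @adjoin ℚ _ Ksqrt69 _ Ksqrt69.algebra' {(α : Ksqrt69), (β : Ksqrt69)} = ⊤ := by
    refine lift_injective Ksqrt69 ?_
    rw [lift_adjoin, lift_top, Set.image_pair, hα, hβ]
    rfl
  convert htop <;> exact Subsingleton.elim _ _

/-- Kummer-theoretic criterion for the fundamental unit `ε = (25 + 3√69)/2` of `ℚ(√69)`:
for a prime `p ≡ 1 mod 3`, `p ≠ 23`, with `(-23/p) = 1`, and `P` a prime of
`𝓞_{ℚ(√-3,√69)}` above `p`, the unit `ε` is a cube in the residue field `𝓞/P` iff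
`p = x² + xy + 6y²`. -/
theorem cubic_character_fundamental_unit_sqrt69
    [NumberField Ksqrt69]
    (ε : 𝓞 Ksqrt69)
    (hε : ((ε : Ksqrt69) : ℂ) = (25 + 3 * ((Real.sqrt 69 : ℝ) : ℂ)) / 2)
    (p : ℕ) (hp : p.Prime) (hp3 : p % 3 = 1) (hp23 : p ≠ 23)
    (hres : IsSquare ((-23 : ZMod p)))
    (P : Ideal (𝓞 Ksqrt69)) (hP : P.IsPrime) (hPp : ((p : ℕ) : 𝓞 Ksqrt69) ∈ P) :
    (∃ c : 𝓞 Ksqrt69 ⧸ P, c ^ 3 = Ideal.Quotient.mk P ε) ↔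
      ∃ x y : ℤ, (p : ℤ) = x ^ 2 + x * y + 6 * y ^ 2 := by
  have : Fact p.Prime := ⟨hp⟩
  obtain ⟨α, β, hα, hβ, hβ', htop⟩ := exists_generators_Ksqrt69
  have hchar : CharP (𝓞 Ksqrt69 ⧸ P) p := charP_quotient hPp
  have hdvd : ∀ n : ℤ, n ∣ 2 ^ 2 * 3 * 23 → ¬ (p : ℤ) ∣ n := by
    intro n hn h
    have h : p ∣ 2 ^ 2 * 3 * 23 := by exact_mod_cast h.trans hn
    rcases hp.dvd_mul.mp h with h | h
    · rcases hp.dvd_mul.mp h with h | h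
      · have := (Nat.prime_dvd_prime_iff_eq hp Nat.prime_two).mp (hp.dvd_of_dvd_pow h)
        omega
      · have := (Nat.prime_dvd_prime_iff_eq hp Nat.prime_three).mp h
        omega
    · exact hp23 ((Nat.prime_dvd_prime_iff_eq hp (by norm_num)).mp h)
  have hsq3 := isSquare_neg_three hp3
  have hcard : Nat.card (𝓞 Ksqrt69 ⧸ P) = p := by
    refine card_quotient_of_adjoin_sqrt_eq_top hPp hα hβ htop (hdvd _ (by norm_num))
      (hdvd _ (by norm_num)) (by exact_mod_cast hsq3) ?_
    have h := hsq3.mul hres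
    norm_num at h
    exact_mod_cast h
  have : Finite (𝓞 Ksqrt69 ⧸ P) := Nat.finite_of_card_ne_zero (hcard ▸ hp.ne_zero)
  have : P.IsMaximal := Ideal.Quotient.maximal_of_isField _ (Finite.isField_of_domain _)
  let _ : Field (𝓞 Ksqrt69 ⧸ P) := Ideal.Quotient.field P
  have h2 : (2 : 𝓞 Ksqrt69 ⧸ P) ≠ 0 := by
    have := (CharP.intCast_eq_zero_iff (𝓞 Ksqrt69 ⧸ P) p 2).not.mpr (hdvd _ (by norm_num))
    exact_mod_cast this
  have hr : Ideal.Quotient.mk P β ^ 2 = 69 := by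
    rw [← map_pow, hβ, map_intCast]
    norm_num
  have hε2 : 2 * ε = 25 + 3 * β := by
    let f : 𝓞 Ksqrt69 →+* ℂ :=
      (Ksqrt69.val : Ksqrt69 →+* ℂ).comp (algebraMap (𝓞 Ksqrt69) Ksqrt69)
    have hf : Function.Injective f := Subtype.val_injective.comp RingOfIntegers.coe_injective
    have hfε : f ε = (25 + 3 * ((Real.sqrt 69 : ℝ) : ℂ)) / 2 := hε
    have hfβ : f β = ((Real.sqrt 69 : ℝ) : ℂ) := hβ'
    apply hf
    rw [map_mul, map_add, map_mul, map_ofNat, map_ofNat, map_ofNat, hfε, hfβ]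
    ring
  have hmk2 := congrArg (Ideal.Quotient.mk P) hε2
  rw [map_mul, map_add, map_mul, map_ofNat, map_ofNat, map_ofNat] at hmk2
  have hmk : Ideal.Quotient.mk P ε = (25 + 3 * Ideal.Quotient.mk P β) / 2 := by
    rw [eq_div_iff h2, mul_comm]
    exact hmk2
  have hε0 : Ideal.Quotient.mk P ε ≠ 0 := by
    rw [hmk]
    intro h
    rw [div_eq_zero_iff, or_iff_left h2] at h
    have h4 : ((4 : ℤ) : 𝓞 Ksqrt69 ⧸ P) = 0 := by
      push_cast
      linear_combination (25 - 3 * Ideal.Quotient.mk P β) * h + 9 * hr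
    rw [CharP.intCast_eq_zero_iff _ p] at h4
    exact hdvd _ (by norm_num) h4
  rw [EisensteinInt.exists_pow_three_eq_iff hcard hp3 hε0, hmk]
  constructor
  · intro h
    refine (EisensteinInt.form_reduction hp (by rintro rfl; norm_num at hp3) hres).resolve_right ?_
    rintro ⟨x, y, hxy⟩
    obtain ⟨z, b, m, c, hc, hcert⟩ :=
      EisensteinInt.exists_isCertificate_of_nonprincipal hp hp3 hxy
    obtain ⟨φ, hφ⟩ := EisensteinInt.cubicSymbol_eq_unit_pow hp hp3 hp23 hr hcert
    exact hc (EisensteinInt.eq_one_of_map_eq_one (EisensteinInt.three_ne_zero_of_charP p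
      (by rintro rfl; norm_num at hp3)) φ hcert.pow_three (hφ.trans h))
  · rintro ⟨x, y, hxy⟩
    obtain ⟨z, b, m, hcert⟩ := EisensteinInt.exists_isCertificate_of_principal hp hp3 hxy
    obtain ⟨φ, hφ⟩ := EisensteinInt.cubicSymbol_eq_unit_pow hp hp3 hp23 hr hcert
    rw [← hφ, map_one]
end
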